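/- For any integers γ, δ ≥ 1, any u ∈ k^*, and any α ∈ Aff_3(k) \ B, there exist integers γ' ≥ γ and δ' ≥ δ and a lift α' of α such that (φ'_u ∘ α')(P_{γ,δ}) ⊆ P_{γ',δ'}. -/

import Mathlib

open MvPolynomial

noncomputable section

namespace YasudaPaper

variable {k : Type*} [Field k]

/-- `f := x1*x3 - x2^2` (variables: `X 0 = x1, X 1 = x2, X 2 = x3`). -/
def fP : MvPolynomial (Fin 3) k := X 0 * X 2 - X 1 ^ 2

/-- `r := x2*f + x1^2`. -/
def rP : MvPolynomial (Fin 3) k := X 1 * fP + X 0 ^ 2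

/-- `g := x3*f^2 + 2*x1*x2*f + x1^3`. -/
def gP : MvPolynomial (Fin 3) k := X 2 * fP ^ 2 + 2 * X 0 * X 1 * fP + X 0 ^ 3

/-- The Jacobian derivation `Δ = Δ_{(f,g)}`, `h ↦ det ∂(f,g,h)/∂(x1,x2,x3)`. -/
def Del (h : MvPolynomial (Fin 3) k) : MvPolynomial (Fin 3) k :=
  Matrix.det !![pderiv 0 fP, pderiv 1 fP, pderiv 2 fP;
                pderiv 0 gP, pderiv 1 gP, pderiv 2 gP;
                pderiv 0 h,  pderiv 1 h,  pderiv 2 h]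

/-- `φ = exp D`: for every `h` and every `N` with `D^[N] h = 0`,
    `φ h = ∑_{i<N} D^i(h)/i!`.  (For a locally nilpotent `D` this characterizes
    the exponential automorphism.) -/
def IsExpOf {σ : Type*} (D : MvPolynomial σ k → MvPolynomial σ k)
    (φ : MvPolynomial σ k ≃ₐ[k] MvPolynomial σ k) : Prop :=
  ∀ (h : MvPolynomial σ k) (N : ℕ), D^[N] h = 0 →
    φ h = ∑ i ∈ Finset.range N, (Nat.factorial i : k)⁻¹ • D^[i] h

/-- `α` is an affine automorphism: `α(x_i) = ∑_j a_{j,i} x_j + b_i` with `A ∈ GL₃(k)`. -/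
def IsAffine (α : MvPolynomial (Fin 3) k ≃ₐ[k] MvPolynomial (Fin 3) k) : Prop :=
  ∃ (A : Matrix (Fin 3) (Fin 3) k) (b : Fin 3 → k), IsUnit A.det ∧
    ∀ i : Fin 3, α (X i) = (∑ j : Fin 3, C (A j i) * X j) + C (b i)

/-- `Aff_3(k)` as a set of automorphisms. -/
def AffSet : Set (MvPolynomial (Fin 3) k ≃ₐ[k] MvPolynomial (Fin 3) k) := {α | IsAffine α}

/-- `α` is a triangular automorphism: `α(x_i) = a_i x_i + f_i(x_1,…,x_{i-1})`, `a_i ≠ 0`. -/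
def IsTriangular (α : MvPolynomial (Fin 3) k ≃ₐ[k] MvPolynomial (Fin 3) k) : Prop :=
  ∃ (a : Fin 3 → k) (p : Fin 3 → MvPolynomial (Fin 3) k),
    (∀ i, a i ≠ 0) ∧ (∀ i, p i ∈ MvPolynomial.supported k {j | j < i}) ∧
    (∀ i, α (X i) = C (a i) * X i + p i)

/-- `BA_3(k)` as a set of automorphisms. -/
def TriSet : Set (MvPolynomial (Fin 3) k ≃ₐ[k] MvPolynomial (Fin 3) k) := {α | IsTriangular α}

/-- The tame subgroup `TA_3(k) = ⟨Aff_3(k), BA_3(k)⟩`. -/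
def TA : Subgroup (MvPolynomial (Fin 3) k ≃ₐ[k] MvPolynomial (Fin 3) k) :=
  Subgroup.closure (AffSet ∪ TriSet)

/-- `β = β_u = (u^3 x1, u^2 x2, u x3)`. -/
def IsBeta (u : k) (β : MvPolynomial (Fin 3) k ≃ₐ[k] MvPolynomial (Fin 3) k) : Prop :=
  β (X 0) = C (u ^ 3) * X 0 ∧ β (X 1) = C (u ^ 2) * X 1 ∧ β (X 2) = C u * X 2

/-- `B = {β_u | u ∈ k^*}`. -/
def BSet : Set (MvPolynomial (Fin 3) k ≃ₐ[k] MvPolynomial (Fin 3) k) :=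
  {β | ∃ u : k, u ≠ 0 ∧ IsBeta u β}

/-! Six-variable ring `k[x1,x2,x3,t_r,t_f,t_g]`:
variables `X 0 = x1, X 1 = x2, X 2 = x3, X 3 = t_r, X 4 = t_f, X 5 = t_g`. -/

/-- The inclusion of variable index sets. -/
def ι36 : Fin 3 → Fin 6 := Fin.castLE (by norm_num)

/-- The embedding `k[x1,x2,x3] → k[x1,x2,x3,t_r,t_f,t_g]`. -/
def embP : MvPolynomial (Fin 3) k →ₐ[k] MvPolynomial (Fin 6) k := rename ι36

/-- The substitution map `π : t_r ↦ r, t_f ↦ f, t_g ↦ g` (fixing `x1,x2,x3`). -/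
def piMap : MvPolynomial (Fin 6) k →ₐ[k] MvPolynomial (Fin 3) k :=
  aeval ![X 0, X 1, X 2, rP, fP, gP]

/-- The triangular derivation
`Δ' = -2 t_r t_f ∂/∂x1 + (4 x1 t_r - t_g) ∂/∂x2 + (6 x2 t_r + 2 t_f²) ∂/∂x3 - t_f t_g ∂/∂t_r`. -/
def Del' (p : MvPolynomial (Fin 6) k) : MvPolynomial (Fin 6) k :=
  (-(2 * X 3 * X 4)) * pderiv 0 p + (4 * X 0 * X 3 - X 5) * pderiv 1 p +
  (6 * X 1 * X 3 + 2 * X 4 ^ 2) * pderiv 2 p + (-(X 4 * X 5)) * pderiv 3 p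

/-- The weight `w1 = (1,2,3,1,0,1)`. -/
def w1 : Fin 6 → ℕ := ![1, 2, 3, 1, 0, 1]

/-- The weight `w2 = (0,0,0,0,1,0)`. -/
def w2 : Fin 6 → ℕ := ![0, 0, 0, 0, 1, 0]

/-- The sixth cyclic lexicographic order on exponent vectors: first compare the
exponent of `t_g`, then lexicographically the exponents of `x1,x2,x3,t_r,t_f`. -/
def cyclicLt (a b : Fin 6 →₀ ℕ) : Prop :=
  a 5 < b 5 ∨ (a 5 = b 5 ∧ ∃ m : Fin 5,
    (∀ l : Fin 5, l < m → a l.castSucc = b l.castSucc) ∧ a m.castSucc < b m.castSucc)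

/-- The leading monomial of `p` (for the sixth cyclic lexicographic order) is `m`. -/
def LeadMonIs (p : MvPolynomial (Fin 6) k) (m : Fin 6 →₀ ℕ) : Prop :=
  m ∈ p.support ∧ ∀ m' ∈ p.support, m' ≠ m → cyclicLt m' m

/-- The exponent vector of the monomial `t_f^δ t_g^γ`. -/
def tfMon (γ δ : ℕ) : Fin 6 →₀ ℕ := Finsupp.single 4 δ + Finsupp.single 5 γ

/-- The set `P_{γ,δ}`. -/
def Pset (γ δ : ℕ) : Set (MvPolynomial (Fin 6) k) :=
  {p | p ≠ 0 ∧ weightedTotalDegree w1 p ≤ γ ∧ weightedTotalDegree w2 p ≤ δ ∧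
    LeadMonIs p (tfMon γ δ)}

/-- `α'` is a lift of `α`. -/
def IsLift (α : MvPolynomial (Fin 3) k ≃ₐ[k] MvPolynomial (Fin 3) k)
    (α' : MvPolynomial (Fin 6) k →ₐ[k] MvPolynomial (Fin 6) k) : Prop :=
  (∀ i : Fin 3, α' (X (ι36 i)) = embP (α (X i))) ∧
  (∀ p, piMap (α' p) = α (piMap p))

/-- `t = γ_j = max {i | a_{i,j} ≠ 0}` (with rows indexed `1,2,3`). -/
def TypeIs (A : Matrix (Fin 3) (Fin 3) k) (j : Fin 3) (t : ℕ) : Prop :=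
  ∃ i : Fin 3, t = (i : ℕ) + 1 ∧ A i j ≠ 0 ∧ ∀ i' : Fin 3, i < i' → A i' j = 0

/-- Condition (C) for a lift `α'` of an affine automorphism of type `(γ1,γ2,γ3)`,
relative to `φ' = exp(uΔ')`. -/
def CondC (γ1 γ2 γ3 : ℕ) (φ' : MvPolynomial (Fin 6) k ≃ₐ[k] MvPolynomial (Fin 6) k)
    (α' : MvPolynomial (Fin 6) k →ₐ[k] MvPolynomial (Fin 6) k) : Prop :=
  ∃ m4 m5 m6 n4 n5 n6 : ℕ,
    1 ≤ n4 ∧ 1 ≤ n5 ∧ 1 ≤ n6 ∧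
    φ' (α' (X 3)) ∈ Pset m4 n4 ∧
    φ' (α' (X 4)) ∈ Pset m5 n5 ∧
    φ' (α' (X 5)) ∈ Pset m6 n6 ∧
    γ1 ≤ m6 ∧ γ2 ≤ 2 * m6 ∧ γ3 ≤ 3 * m6 ∧ m4 ≤ m6 ∧
    γ1 + 1 ≤ n6 - 1 ∧ γ2 + 1 ≤ 2 * (n6 - 1) ∧ γ3 + 1 ≤ 3 * (n6 - 1) ∧ n4 ≤ n6 - 1

/-- The image of `x_j` under the affine map given by `(A, d)`, inside the six-variable ring. -/
def affImg (A : Matrix (Fin 3) (Fin 3) k) (d : Fin 3 → k) (j : Fin 3) :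
    MvPolynomial (Fin 6) k :=
  (∑ i : Fin 3, C (A i j) * X (ι36 i)) + C (d j)

/-- The image of `t_f` under the lift `α̂`:
`α̂(t_f) = α(f) + (a_{1,1}a_{3,3} - 2a_{1,2}a_{3,2} + a_{1,3}a_{3,1})(t_f - f)`. -/
def hatTf (A : Matrix (Fin 3) (Fin 3) k) (d : Fin 3 → k) : MvPolynomial (Fin 6) k :=
  (affImg A d 0 * affImg A d 2 - affImg A d 1 ^ 2) +
    C (A 0 0 * A 2 2 - 2 * (A 0 1 * A 2 1) + A 0 2 * A 2 0) *
      (X 4 - (X 0 * X 2 - X 1 ^ 2))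

/-- The lift `α̂` of the affine automorphism given by `(A, d)`:
`α̂(x_i) = α(x_i)`, `α̂(t_f)` as in `hatTf`, `α̂(t_r) = α̂(x2 t_f + x1²)`,
`α̂(t_g) = α̂(x3 t_f² + 2 x1 x2 t_f + x1³)`. -/
def hatLift (A : Matrix (Fin 3) (Fin 3) k) (d : Fin 3 → k) :
    MvPolynomial (Fin 6) k →ₐ[k] MvPolynomial (Fin 6) k :=
  aeval ![affImg A d 0, affImg A d 1, affImg A d 2,
    affImg A d 1 * hatTf A d + affImg A d 0 ^ 2,
    hatTf A d,
    affImg A d 2 * hatTf A d ^ 2 + 2 * affImg A d 0 * affImg A d 1 * hatTf A d +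
      affImg A d 0 ^ 3]

/-- Every monomial of `p` has `w1`-weight at most `m` and `w2`-weight at most `n`. -/
def InV (m n : ℕ) (p : MvPolynomial (Fin 6) k) : Prop :=
  ∀ e ∈ p.support, e 0 + 2 * e 1 + 3 * e 2 + e 3 + e 5 ≤ m ∧ e 4 ≤ n

/-- `p` is bounded by `(m, n)` in the weights `(w1, w2)` and `c` is its coefficient at
`t_f ^ n * t_g ^ m`. -/
def HasTop (m n : ℕ) (p : MvPolynomial (Fin 6) k) (c : k) : Prop :=
  InV m n p ∧ coeff (tfMon m n) p = c

lemma weight_w1 (e : Fin 6 →₀ ℕ) :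
    Finsupp.weight w1 e = e 0 + 2 * e 1 + 3 * e 2 + e 3 + e 5 := by
  rw [Finsupp.weight_apply, Finsupp.sum_fintype _ _ (by simp)]
  simp [Fin.sum_univ_six, w1]
  ring

lemma weight_w2 (e : Fin 6 →₀ ℕ) : Finsupp.weight w2 e = e 4 := by
  rw [Finsupp.weight_apply, Finsupp.sum_fintype _ _ (by simp)]
  simp [Fin.sum_univ_six, w2]

lemma inV_iff {m n : ℕ} {p : MvPolynomial (Fin 6) k} :
    InV m n p ↔ weightedTotalDegree w1 p ≤ m ∧ weightedTotalDegree w2 p ≤ n := by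
  simp only [weightedTotalDegree, Finset.sup_le_iff, weight_w1, weight_w2, InV]
  exact ⟨fun h => ⟨fun e he => (h e he).1, fun e he => (h e he).2⟩,
    fun h e he => ⟨h.1 e he, h.2 e he⟩⟩

lemma eq_tfMon {m n : ℕ} {e : Fin 6 →₀ ℕ} (h0 : e 0 = 0) (h1 : e 1 = 0) (h2 : e 2 = 0)
    (h3 : e 3 = 0) (h4 : e 4 = n) (h5 : e 5 = m) : e = tfMon m n := by
  ext i
  fin_cases i <;> simp [tfMon, h0, h1, h2, h3, h4, h5]

lemma tfMon_apply (m n : ℕ) : tfMon m n 0 = 0 ∧ tfMon m n 1 = 0 ∧ tfMon m n 2 = 0 ∧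
    tfMon m n 3 = 0 ∧ tfMon m n 4 = n ∧ tfMon m n 5 = m := by
  simp [tfMon]

lemma HasTop.mem_Pset {m n : ℕ} {p : MvPolynomial (Fin 6) k} {c : k}
    (h : HasTop m n p c) (hc : c ≠ 0) : p ∈ Pset m n := by
  obtain ⟨hV, hcf⟩ := h
  have hmem : tfMon m n ∈ p.support := by rw [mem_support_iff, hcf]; exact hc
  refine ⟨?_, (inV_iff.1 hV).1, (inV_iff.1 hV).2, hmem, ?_⟩
  · rintro rfl
    simp at hmem
  · intro e he hne
    obtain ⟨ha, hb⟩ := hV e he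
    obtain ⟨t0, t1, t2, t3, t4, t5⟩ := tfMon_apply m n
    by_cases h5 : e 5 = m
    · right
      refine ⟨by rw [h5, t5], 4, ?_, ?_⟩
      · intro l hl
        fin_cases l
        · change e 0 = tfMon m n 0
          omega
        · change e 1 = tfMon m n 1
          omega
        · change e 2 = tfMon m n 2
          omega
        · change e 3 = tfMon m n 3
          omega
        · exact absurd hl (lt_irrefl _)
      · change e 4 < tfMon m n 4
        rw [t4]
        refine lt_of_le_of_ne hb fun h4 => hne (eq_tfMon ?_ ?_ ?_ ?_ h4 h5) <;> omega
    · left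
      rw [t5]
      omega

lemma hasTop_of_mem_Pset {m n : ℕ} {p : MvPolynomial (Fin 6) k} (h : p ∈ Pset m n) :
    ∃ c, c ≠ 0 ∧ HasTop m n p c :=
  ⟨_, mem_support_iff.1 h.2.2.2.1, inV_iff.2 ⟨h.2.1, h.2.2.1⟩, rfl⟩

lemma InV.mono {m n m' n' : ℕ} {p : MvPolynomial (Fin 6) k} (h : InV m n p)
    (hm : m ≤ m') (hn : n ≤ n') : InV m' n' p :=
  fun e he => ⟨(h e he).1.trans hm, (h e he).2.trans hn⟩

lemma InV.add {m n : ℕ} {p q : MvPolynomial (Fin 6) k} (hp : InV m n p) (hq : InV m n q) :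
    InV m n (p + q) := by
  classical
  intro e he
  rcases Finset.mem_union.1 (support_add he) with h | h
  exacts [hp e h, hq e h]

lemma InV.mul {m n m' n' : ℕ} {p q : MvPolynomial (Fin 6) k} (hp : InV m n p)
    (hq : InV m' n' q) : InV (m + m') (n + n') (p * q) := by
  classical
  intro e he
  obtain ⟨a, ha, b, hb, rfl⟩ := Finset.mem_add.1 (support_mul p q he)
  have h1 := hp a ha
  have h2 := hq b hb
  simp only [Finsupp.add_apply]
  omega

lemma HasTop.inV {m n : ℕ} {p : MvPolynomial (Fin 6) k} {c : k} (h : HasTop m n p c) :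
    InV m n p := h.1

lemma HasTop.congr {m n : ℕ} {p : MvPolynomial (Fin 6) k} {c c' : k} (h : HasTop m n p c)
    (hc : c = c') : HasTop m n p c' := hc ▸ h

lemma HasTop.add {m n : ℕ} {p q : MvPolynomial (Fin 6) k} {c d : k}
    (hp : HasTop m n p c) (hq : HasTop m n q d) : HasTop m n (p + q) (c + d) :=
  ⟨hp.1.add hq.1, by rw [coeff_add, hp.2, hq.2]⟩

lemma HasTop.mul {m n m' n' : ℕ} {p q : MvPolynomial (Fin 6) k} {c d : k}
    (hp : HasTop m n p c) (hq : HasTop m' n' q d) :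
    HasTop (m + m') (n + n') (p * q) (c * d) := by
  classical
  refine ⟨hp.1.mul hq.1, ?_⟩
  rw [coeff_mul, Finset.sum_eq_single (tfMon m n, tfMon m' n'), hp.2, hq.2]
  · rintro ⟨a, b⟩ hab hne
    by_contra hcon
    have ha := hp.1 a (mem_support_iff.2 (left_ne_zero_of_mul hcon))
    have hb := hq.1 b (mem_support_iff.2 (right_ne_zero_of_mul hcon))
    rw [Finset.HasAntidiagonal.mem_antidiagonal] at hab
    obtain ⟨-, -, -, -, t4, t5⟩ := tfMon_apply (m + m') (n + n')
    have e4 := DFunLike.congr_fun hab 4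
    have e5 := DFunLike.congr_fun hab 5
    simp only [Finsupp.add_apply] at e4 e5
    apply hne
    rw [Prod.mk.injEq]
    constructor <;> apply eq_tfMon <;> omega
  · intro h
    refine absurd (Finset.HasAntidiagonal.mem_antidiagonal.2 ?_) h
    simp only [tfMon, Finsupp.single_add]
    abel

lemma HasTop.of_lt {m n m' n' : ℕ} {p : MvPolynomial (Fin 6) k} {c : k}
    (h : HasTop m n p c) (hm : m ≤ m') (hn : n ≤ n') (hlt : m + n < m' + n') :
    HasTop m' n' p 0 := by
  refine ⟨h.1.mono hm hn, ?_⟩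
  by_contra hcon
  have := h.1 _ (mem_support_iff.2 hcon)
  obtain ⟨-, -, -, -, t4, t5⟩ := tfMon_apply m' n'
  omega

lemma hasTop_C (a : k) : HasTop 0 0 (C a) a := by
  classical
  constructor
  · intro e he
    rw [mem_support_iff, coeff_C] at he
    obtain rfl : (0 : Fin 6 →₀ ℕ) = e := by
      by_contra h
      simp [h] at he
    simp
  · simp [tfMon]

lemma HasTop.C_mul {m n : ℕ} {p : MvPolynomial (Fin 6) k} {c : k} (h : HasTop m n p c)
    (a : k) : HasTop m n (C a * p) (a * c) := by
  simpa using (hasTop_C a).mul h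

lemma HasTop.pow {m n : ℕ} {p : MvPolynomial (Fin 6) k} {c : k} (h : HasTop m n p c) (j : ℕ) :
    HasTop (m * j) (n * j) (p ^ j) (c ^ j) := by
  induction j with
  | zero => simpa using hasTop_C (1 : k)
  | succ j ih => simpa only [pow_succ, Nat.mul_succ] using ih.mul h

lemma HasTop.C_mul_of {m n m' n' : ℕ} {p : MvPolynomial (Fin 6) k} {c : k}
    (h : HasTop m n p c) (a : k) (ha : a = 0 ∨ m ≤ m' ∧ n ≤ n') :
    HasTop m' n' (C a * p) (if m = m' ∧ n = n' then a * c else 0) := by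
  rcases ha with rfl | ⟨hm, hn⟩
  · refine ⟨fun e he => ?_, ?_⟩ <;> simp at *
  · split_ifs with heq
    · obtain ⟨rfl, rfl⟩ := heq
      exact h.C_mul a
    · exact (h.C_mul a).of_lt hm hn (by omega)

lemma inV_iff_hasTop {m n : ℕ} {p : MvPolynomial (Fin 6) k} :
    InV m n p ↔ HasTop m n p (coeff (tfMon m n) p) := ⟨fun h => ⟨h, rfl⟩, fun h => h.1⟩

lemma InV.pow {m n : ℕ} {p : MvPolynomial (Fin 6) k} (h : InV m n p) (j : ℕ) :
    InV (m * j) (n * j) (p ^ j) := ((inV_iff_hasTop.1 h).pow j).1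

lemma InV.C_mul {m n : ℕ} {p : MvPolynomial (Fin 6) k} (h : InV m n p) (a : k) :
    InV m n (C a * p) := ((inV_iff_hasTop.1 h).C_mul a).1

lemma hasTop_X (i : Fin 6) :
    HasTop (w1 i) (w2 i) (X i : MvPolynomial (Fin 6) k) (if i = 4 ∨ i = 5 then 1 else 0) := by
  classical
  constructor
  · intro e he
    rw [mem_support_iff, coeff_X] at he
    obtain rfl : Finsupp.single i 1 = e := by
      by_contra h
      simp [h] at he
    fin_cases i <;> simp [w1, w2]
  · rw [coeff_X]
    congr 1
    rw [eq_iff_iff]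
    constructor
    · intro h
      have := DFunLike.congr_fun h i
      fin_cases i <;> simp [tfMon, w1, w2] at this ⊢
    · rintro (rfl | rfl) <;> simp [tfMon, w1, w2]

/-- An algebra endomorphism whose values on the variables are suitably bounded maps `P_{γ,δ}`
into `P_{γ',δ'}`. -/
lemma image_mem_Pset (ψ : MvPolynomial (Fin 6) k →ₐ[k] MvPolynomial (Fin 6) k)
    {m5 n5 m6 n6 γ δ : ℕ} {c4 c5 : k} (h0 : InV m6 n6 (ψ (X 0)))
    (h1 : InV (2 * m6) (2 * n6) (ψ (X 1))) (h2 : InV (3 * m6) (3 * n6) (ψ (X 2)))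
    (h3 : InV m6 n6 (ψ (X 3))) (h4 : HasTop m5 n5 (ψ (X 4)) c4)
    (h5 : HasTop m6 (n6 + 1) (ψ (X 5)) c5) (hn5 : 1 ≤ n5) (hc4 : c4 ≠ 0) (hc5 : c5 ≠ 0)
    {p : MvPolynomial (Fin 6) k} (hp : p ∈ Pset γ δ) :
    ψ p ∈ Pset (m6 * γ + m5 * δ) ((n6 + 1) * γ + n5 * δ) := by
  classical
  obtain ⟨c, hc, hV, hcf⟩ := hasTop_of_mem_Pset hp
  have hmon : ∀ e ∈ p.support, HasTop (m6 * γ + m5 * δ) ((n6 + 1) * γ + n5 * δ)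
      (ψ (monomial e (coeff e p))) (if e = tfMon γ δ then c * (c4 ^ δ * c5 ^ γ) else 0) := by
    intro e he
    have hform : ψ (monomial e (coeff e p)) = C (coeff e p) * (ψ (X 0) ^ e 0 * ψ (X 1) ^ e 1 *
        ψ (X 2) ^ e 2 * ψ (X 3) ^ e 3 * ψ (X 4) ^ e 4 * ψ (X 5) ^ e 5) := by
      rw [monomial_eq, Finsupp.prod_fintype _ _ (by simp), map_mul, map_prod, algHom_C]
      simp [Fin.prod_univ_six, algebraMap_eq]
    rw [hform]
    split_ifs with heq
    · subst heq
      obtain ⟨t0, t1, t2, t3, t4, t5⟩ := tfMon_apply γ δ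
      rw [t0, t1, t2, t3, t4, t5, hcf]
      simp only [pow_zero, one_mul]
      have := ((h4.pow δ).mul (h5.pow γ)).C_mul c
      convert this using 1 <;> ring
    · have hb := (((((((inV_iff_hasTop.1 h0).pow (e 0)).mul ((inV_iff_hasTop.1 h1).pow (e 1))).mul
        ((inV_iff_hasTop.1 h2).pow (e 2))).mul ((inV_iff_hasTop.1 h3).pow (e 3))).mul
        (h4.pow (e 4))).mul (h5.pow (e 5))).C_mul (coeff e p)
      obtain ⟨ha1, ha2⟩ := hV e he
      have hne : e 5 < γ ∨ e 4 < δ := by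
        by_contra! hcon
        exact heq (eq_tfMon (by omega) (by omega) (by omega) (by omega) (by omega) (by omega))
      have k1 := Nat.mul_le_mul_left m6 ha1
      have k2 := Nat.mul_le_mul_left m5 ha2
      have k3 := Nat.mul_le_mul_left n6 ha1
      have k4 := Nat.mul_le_mul_left n5 ha2
      have k5 : e 5 + n5 * e 4 < γ + n5 * δ := by
        rcases hne with h | h
        · omega
        · have := Nat.mul_lt_mul_of_pos_left h hn5
          omega
      refine hb.of_lt ?_ ?_ ?_ <;> nlinarith
  have hsum : HasTop (m6 * γ + m5 * δ) ((n6 + 1) * γ + n5 * δ) (ψ p)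
      (∑ e ∈ p.support, if e = tfMon γ δ then c * (c4 ^ δ * c5 ^ γ) else 0) := by
    conv => arg 3; rw [p.as_sum, map_sum]
    refine ⟨?_, ?_⟩
    · refine Finset.sum_induction _ (InV _ _) (fun _ _ => InV.add) ?_ fun e he => (hmon e he).1
      intro e he
      simp at he
    · rw [coeff_sum]
      exact Finset.sum_congr rfl fun e he => (hmon e he).2
  refine hsum.mem_Pset ?_
  rw [Finset.sum_ite_eq' p.support, if_pos (mem_support_iff.2 (by rw [hcf]; exact hc))]
  exact mul_ne_zero hc (mul_ne_zero (pow_ne_zero _ hc4) (pow_ne_zero _ hc5))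

/-- The top coefficients of the images of the variables under `exp (u • Del')`. -/
structure ExpTops (u : k) (φ : MvPolynomial (Fin 6) k →ₐ[k] MvPolynomial (Fin 6) k) : Prop where
  x0 : HasTop 1 2 (φ (X 0)) (u ^ 2)
  x1 : HasTop 2 3 (φ (X 1)) (-u ^ 4)
  x2 : HasTop 3 4 (φ (X 2)) (u ^ 6)
  r : HasTop 1 1 (φ (X 3)) (-u)
  f : HasTop 0 1 (φ (X 4)) 1
  g : HasTop 1 0 (φ (X 5)) 1

lemma Del'_smul (u : k) (p : MvPolynomial (Fin 6) k) : Del' (C u * p) = C u * Del' p := by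
  simp only [Del', pderiv_C_mul]
  ring

lemma iterate_smul_Del' (u : k) (p : MvPolynomial (Fin 6) k) (i : ℕ) :
    (fun p => u • Del' p)^[i] p = C (u ^ i) * Del'^[i] p := by
  induction i with
  | zero => simp
  | succ i ih =>
    rw [Function.iterate_succ_apply', ih, Function.iterate_succ_apply', Del'_smul,
      smul_eq_C_mul, pow_succ, C_mul]
    ring

lemma IsExpOf.apply_eq {u : k} {φ : MvPolynomial (Fin 6) k ≃ₐ[k] MvPolynomial (Fin 6) k}
    (hφ : IsExpOf (fun p => u • Del' p) φ) {p : MvPolynomial (Fin 6) k} {N : ℕ}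
    (hN : Del'^[N] p = 0) :
    φ p = ∑ i ∈ Finset.range N, C ((Nat.factorial i : k)⁻¹ * u ^ i) * Del'^[i] p := by
  rw [hφ p N (by rw [iterate_smul_Del', hN, mul_zero])]
  refine Finset.sum_congr rfl fun i _ => ?_
  rw [iterate_smul_Del', smul_eq_C_mul, C_mul, mul_assoc]

lemma Del'_X0 : Del' (X 0 : MvPolynomial (Fin 6) k) = -2 * (X 3 * X 4) := by
  simp [Del', pderiv_X]
  ring

lemma Del'_X1 : Del' (X 1 : MvPolynomial (Fin 6) k) = 4 * (X 0 * X 3) - X 5 := by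
  simp [Del', pderiv_X]
  ring

lemma Del'_X2 : Del' (X 2 : MvPolynomial (Fin 6) k) = 6 * (X 1 * X 3) + 2 * X 4 ^ 2 := by
  simp [Del', pderiv_X]
  ring

lemma Del'_X3 : Del' (X 3 : MvPolynomial (Fin 6) k) = -(X 4 * X 5) := by
  simp [Del', pderiv_X]

lemma Del'_X4 : Del' (X 4 : MvPolynomial (Fin 6) k) = 0 := by simp [Del', pderiv_X]

lemma Del'_X5 : Del' (X 5 : MvPolynomial (Fin 6) k) = 0 := by simp [Del', pderiv_X]

lemma Del'_add (p q : MvPolynomial (Fin 6) k) : Del' (p + q) = Del' p + Del' q := by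
  simp only [Del', map_add]
  ring

lemma Del'_mul (p q : MvPolynomial (Fin 6) k) : Del' (p * q) = p * Del' q + q * Del' p := by
  simp only [Del', Derivation.leibniz, smul_eq_mul]
  ring

lemma Del'_C (a : k) : Del' (C a : MvPolynomial (Fin 6) k) = 0 := by simp [Del']

lemma Del'_pow (p : MvPolynomial (Fin 6) k) (n : ℕ) :
    Del' (p ^ n) = n * p ^ (n - 1) * Del' p := by
  simp only [Del', Derivation.leibniz_pow, smul_eq_mul, nsmul_eq_mul]
  ring

lemma Del'_ofNat (n : ℕ) [n.AtLeastTwo] :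
    Del' (ofNat(n) : MvPolynomial (Fin 6) k) = 0 := by
  rw [← map_ofNat C n, Del'_C]

lemma Del'_neg (p : MvPolynomial (Fin 6) k) : Del' (-p) = -Del' p := by
  simp only [Del', map_neg]
  ring

lemma Del'_sub (p q : MvPolynomial (Fin 6) k) : Del' (p - q) = Del' p - Del' q := by
  rw [sub_eq_add_neg, Del'_add, Del'_neg, sub_eq_add_neg]

lemma iterate_Del'_X3_two : Del' (-(X 4 * X 5 : MvPolynomial (Fin 6) k)) = 0 := by
  simp only [Del'_neg, Del'_mul, Del'_X4, Del'_X5]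
  ring

lemma iterate_Del'_X0_two :
    Del' (-2 * (X 3 * X 4) : MvPolynomial (Fin 6) k) = 2 * (X 4 ^ 2 * X 5) := by
  simp only [neg_mul, Del'_neg, Del'_ofNat, Del'_mul, Del'_X3, Del'_X4]
  ring

lemma iterate_Del'_X0_three : Del' (2 * (X 4 ^ 2 * X 5) : MvPolynomial (Fin 6) k) = 0 := by
  simp only [Del'_ofNat, Del'_mul, Del'_pow, Del'_X4, Del'_X5]
  ring

lemma iterate_Del'_X1_two : Del' (4 * (X 0 * X 3) - X 5 : MvPolynomial (Fin 6) k) =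
    -(8 * (X 3 ^ 2 * X 4)) - 4 * (X 0 * X 4 * X 5) := by
  simp only [Del'_sub, Del'_ofNat, Del'_mul, Del'_X0, Del'_X3, Del'_X5]
  ring

lemma iterate_Del'_X1_three :
    Del' (-(8 * (X 3 ^ 2 * X 4)) - 4 * (X 0 * X 4 * X 5) : MvPolynomial (Fin 6) k) =
      24 * (X 3 * X 4 ^ 2 * X 5) := by
  simp only [Del'_sub, Del'_neg, Del'_ofNat, Del'_mul, Del'_pow, Del'_X0, Del'_X3, Del'_X4,
    Del'_X5]
  push_cast
  ring

lemma iterate_Del'_X1_four :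
    Del' (24 * (X 3 * X 4 ^ 2 * X 5) : MvPolynomial (Fin 6) k) = -(24 * (X 4 ^ 3 * X 5 ^ 2)) := by
  simp only [Del'_ofNat, Del'_mul, Del'_pow, Del'_X3, Del'_X4, Del'_X5]
  ring

lemma iterate_Del'_X1_five :
    Del' (-(24 * (X 4 ^ 3 * X 5 ^ 2)) : MvPolynomial (Fin 6) k) = 0 := by
  simp only [Del'_neg, Del'_ofNat, Del'_mul, Del'_pow, Del'_X4, Del'_X5]
  ring

lemma iterate_Del'_X2_two : Del' (6 * (X 1 * X 3) + 2 * X 4 ^ 2 : MvPolynomial (Fin 6) k) =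
    24 * (X 0 * X 3 ^ 2) - 6 * (X 3 * X 5) - 6 * (X 1 * X 4 * X 5) := by
  simp only [Del'_add, Del'_ofNat, Del'_mul, Del'_pow, Del'_X1, Del'_X3, Del'_X4]
  ring

lemma iterate_Del'_X2_three :
    Del' (24 * (X 0 * X 3 ^ 2) - 6 * (X 3 * X 5) - 6 * (X 1 * X 4 * X 5) :
      MvPolynomial (Fin 6) k) =
    -(48 * (X 3 ^ 3 * X 4)) - 72 * (X 0 * X 3 * X 4 * X 5) + 12 * (X 4 * X 5 ^ 2) := by
  simp only [Del'_sub, Del'_ofNat, Del'_mul, Del'_pow, Del'_X0, Del'_X1, Del'_X3, Del'_X4,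
    Del'_X5]
  push_cast
  ring

lemma iterate_Del'_X2_four :
    Del' (-(48 * (X 3 ^ 3 * X 4)) - 72 * (X 0 * X 3 * X 4 * X 5) + 12 * (X 4 * X 5 ^ 2) :
      MvPolynomial (Fin 6) k) =
    288 * (X 3 ^ 2 * X 4 ^ 2 * X 5) + 72 * (X 0 * X 4 ^ 2 * X 5 ^ 2) := by
  simp only [Del'_add, Del'_sub, Del'_neg, Del'_ofNat, Del'_mul, Del'_pow, Del'_X0, Del'_X3,
    Del'_X4, Del'_X5]
  push_cast
  ring

lemma iterate_Del'_X2_five :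
    Del' (288 * (X 3 ^ 2 * X 4 ^ 2 * X 5) + 72 * (X 0 * X 4 ^ 2 * X 5 ^ 2) :
      MvPolynomial (Fin 6) k) = -(720 * (X 3 * X 4 ^ 3 * X 5 ^ 2)) := by
  simp only [Del'_add, Del'_ofNat, Del'_mul, Del'_pow, Del'_X0, Del'_X3, Del'_X4, Del'_X5]
  push_cast
  ring

lemma iterate_Del'_X2_six :
    Del' (-(720 * (X 3 * X 4 ^ 3 * X 5 ^ 2)) : MvPolynomial (Fin 6) k) =
      720 * (X 4 ^ 4 * X 5 ^ 3) := by
  simp only [Del'_neg, Del'_ofNat, Del'_mul, Del'_pow, Del'_X3, Del'_X4, Del'_X5]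
  ring

lemma iterate_Del'_X2_seven : Del' (720 * (X 4 ^ 4 * X 5 ^ 3) : MvPolynomial (Fin 6) k) = 0 := by
  simp only [Del'_ofNat, Del'_mul, Del'_pow, Del'_X4, Del'_X5]
  ring

lemma inV_ofNat_mul {m n : ℕ} (j : ℕ) [j.AtLeastTwo] {p : MvPolynomial (Fin 6) k}
    (h : InV m n p) : InV m n (ofNat(j) * p) := by
  rw [← map_ofNat C j]
  exact h.C_mul _

lemma InV.neg {m n : ℕ} {p : MvPolynomial (Fin 6) k} (h : InV m n p) : InV m n (-p) := by
  simpa using h.C_mul (-1)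

lemma InV.sub {m n : ℕ} {p q : MvPolynomial (Fin 6) k} (hp : InV m n p) (hq : InV m n q) :
    InV m n (p - q) := by
  rw [sub_eq_add_neg]
  exact hp.add hq.neg

lemma InV.hasTop_zero {m n m' n' : ℕ} {p : MvPolynomial (Fin 6) k} (h : InV m n p)
    (hm : m ≤ m') (hn : n ≤ n') (hlt : m + n < m' + n') : HasTop m' n' p 0 :=
  (inV_iff_hasTop.1 h).of_lt hm hn hlt

lemma HasTop.sub {m n : ℕ} {p q : MvPolynomial (Fin 6) k} {c d : k}
    (hp : HasTop m n p c) (hq : HasTop m n q d) : HasTop m n (p - q) (c - d) :=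
  ⟨hp.1.sub hq.1, by rw [coeff_sub, hp.2, hq.2]⟩

lemma HasTop.neg {m n : ℕ} {p : MvPolynomial (Fin 6) k} {c : k} (h : HasTop m n p c) :
    HasTop m n (-p) (-c) := by simpa using h.C_mul (-1)

lemma HasTop.ofNat_mul {m n : ℕ} {p : MvPolynomial (Fin 6) k} {c : k} (h : HasTop m n p c)
    (j : ℕ) [j.AtLeastTwo] : HasTop m n (ofNat(j) * p) (ofNat(j) * c) := by
  rw [← map_ofNat C j]
  exact h.C_mul _

lemma IsExpOf.expTops [CharZero k] {u : k}
    {φ : MvPolynomial (Fin 6) k ≃ₐ[k] MvPolynomial (Fin 6) k}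
    (hφ : IsExpOf (fun p => u • Del' p) φ) : ExpTops u (φ : _ →ₐ[k] _) := by
  have h0 : InV 1 0 (X 0 : MvPolynomial (Fin 6) k) := (hasTop_X 0).1
  have h1 : InV 2 0 (X 1 : MvPolynomial (Fin 6) k) := (hasTop_X 1).1
  have h2 : InV 3 0 (X 2 : MvPolynomial (Fin 6) k) := (hasTop_X 2).1
  have h3 : InV 1 0 (X 3 : MvPolynomial (Fin 6) k) := (hasTop_X 3).1
  have h4 : HasTop 0 1 (X 4 : MvPolynomial (Fin 6) k) 1 := by simpa [w1, w2] using hasTop_X 4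
  have h5 : HasTop 1 0 (X 5 : MvPolynomial (Fin 6) k) 1 := by simpa [w1, w2] using hasTop_X 5
  have i4 := h4.inV
  have i5 := h5.inV
  refine ⟨?_, ?_, ?_, ?_, ?_, ?_⟩ <;> rw [AlgEquiv.coe_toAlgHom]
  · rw [hφ.apply_eq (N := 3) (by
      simp only [Function.iterate_succ_apply, Function.iterate_zero_apply, Del'_X0,
        iterate_Del'_X0_two, iterate_Del'_X0_three])]
    simp only [Finset.sum_range_succ, Finset.sum_range_zero, zero_add,
      Function.iterate_succ_apply, Function.iterate_zero_apply, Del'_X0, iterate_Del'_X0_two]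
    have t0 : HasTop 1 2 (X 0 : MvPolynomial (Fin 6) k) 0 :=
      h0.hasTop_zero le_rfl (by simp) (by simp)
    have t1 : HasTop 1 2 (-2 * (X 3 * X 4) : MvPolynomial (Fin 6) k) 0 := by
      rw [neg_mul]
      exact ((inV_ofNat_mul 2 (h3.mul i4)).neg).hasTop_zero (by simp) (by simp) (by simp)
    have t2 : HasTop 1 2 (2 * (X 4 ^ 2 * X 5) : MvPolynomial (Fin 6) k) 2 := by
      simpa using ((h4.pow 2).mul h5).ofNat_mul 2
    refine HasTop.congr (((t0.C_mul _).add (t1.C_mul _)).add (t2.C_mul _)) ?_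
    simp [Nat.factorial]
    field_simp
  · rw [hφ.apply_eq (N := 5) (by
      simp only [Function.iterate_succ_apply, Function.iterate_zero_apply, Del'_X1,
        iterate_Del'_X1_two, iterate_Del'_X1_three, iterate_Del'_X1_four, iterate_Del'_X1_five])]
    simp only [Finset.sum_range_succ, Finset.sum_range_zero, zero_add,
      Function.iterate_succ_apply, Function.iterate_zero_apply, Del'_X1, iterate_Del'_X1_two,
      iterate_Del'_X1_three, iterate_Del'_X1_four]
    have t0 : HasTop 2 3 (X 1 : MvPolynomial (Fin 6) k) 0 :=
      h1.hasTop_zero le_rfl (by simp) (by simp)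
    have t1 : HasTop 2 3 (4 * (X 0 * X 3) - X 5 : MvPolynomial (Fin 6) k) 0 :=
      ((inV_ofNat_mul 4 (h0.mul h3)).sub (i5.mono (by simp) (by simp))).hasTop_zero
        (by simp) (by simp) (by simp)
    have t2 : HasTop 2 3 (-(8 * (X 3 ^ 2 * X 4)) - 4 * (X 0 * X 4 * X 5) :
        MvPolynomial (Fin 6) k) 0 :=
      ((inV_ofNat_mul 8 ((h3.pow 2).mul i4)).neg.sub
        (inV_ofNat_mul 4 ((h0.mul i4).mul i5))).hasTop_zero (by simp) (by simp) (by simp)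
    have t3 : HasTop 2 3 (24 * (X 3 * X 4 ^ 2 * X 5) : MvPolynomial (Fin 6) k) 0 :=
      (inV_ofNat_mul 24 ((h3.mul (i4.pow 2)).mul i5)).hasTop_zero (by simp) (by simp) (by simp)
    have t4 : HasTop 2 3 (-(24 * (X 4 ^ 3 * X 5 ^ 2)) : MvPolynomial (Fin 6) k) (-24) := by
      simpa using (((h4.pow 3).mul (h5.pow 2)).ofNat_mul 24).neg
    refine HasTop.congr (((((t0.C_mul _).add (t1.C_mul _)).add (t2.C_mul _)).add
      (t3.C_mul _)).add (t4.C_mul _)) ?_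
    simp [Nat.factorial]
    field_simp
  · rw [hφ.apply_eq (N := 7) (by
      simp only [Function.iterate_succ_apply, Function.iterate_zero_apply, Del'_X2,
        iterate_Del'_X2_two, iterate_Del'_X2_three, iterate_Del'_X2_four, iterate_Del'_X2_five,
        iterate_Del'_X2_six, iterate_Del'_X2_seven])]
    simp only [Finset.sum_range_succ, Finset.sum_range_zero, zero_add,
      Function.iterate_succ_apply, Function.iterate_zero_apply, Del'_X2, iterate_Del'_X2_two,
      iterate_Del'_X2_three, iterate_Del'_X2_four, iterate_Del'_X2_five, iterate_Del'_X2_six]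
    have t0 : HasTop 3 4 (X 2 : MvPolynomial (Fin 6) k) 0 :=
      h2.hasTop_zero le_rfl (by simp) (by simp)
    have t1 : HasTop 3 4 (6 * (X 1 * X 3) + 2 * X 4 ^ 2 : MvPolynomial (Fin 6) k) 0 :=
      (((inV_ofNat_mul 6 (h1.mul h3)).mono (m' := 3) (n' := 2) (by simp) (by simp)).add
        ((inV_ofNat_mul 2 (i4.pow 2)).mono (by simp) (by simp))).hasTop_zero
        (by simp) (by simp) (by simp)
    have t2 : HasTop 3 4 (24 * (X 0 * X 3 ^ 2) - 6 * (X 3 * X 5) - 6 * (X 1 * X 4 * X 5) :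
        MvPolynomial (Fin 6) k) 0 :=
      ((((inV_ofNat_mul 24 (h0.mul (h3.pow 2))).mono (m' := 3) (n' := 2) (by simp) (by simp)).sub
        ((inV_ofNat_mul 6 (h3.mul i5)).mono (by simp) (by simp))).sub
        ((inV_ofNat_mul 6 ((h1.mul i4).mul i5)).mono (by simp) (by simp))).hasTop_zero
        (by simp) (by simp) (by simp)
    have t3 : HasTop 3 4 (-(48 * (X 3 ^ 3 * X 4)) - 72 * (X 0 * X 3 * X 4 * X 5) +
        12 * (X 4 * X 5 ^ 2) : MvPolynomial (Fin 6) k) 0 :=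
      ((((inV_ofNat_mul 48 ((h3.pow 3).mul i4)).neg.mono (m' := 3) (n' := 2)
        (by simp) (by simp)).sub
        ((inV_ofNat_mul 72 (((h0.mul h3).mul i4).mul i5)).mono (by simp) (by simp))).add
        ((inV_ofNat_mul 12 (i4.mul (i5.pow 2))).mono (by simp) (by simp))).hasTop_zero
        (by simp) (by simp) (by simp)
    have t4 : HasTop 3 4 (288 * (X 3 ^ 2 * X 4 ^ 2 * X 5) + 72 * (X 0 * X 4 ^ 2 * X 5 ^ 2) :
        MvPolynomial (Fin 6) k) 0 :=
      ((inV_ofNat_mul 288 (((h3.pow 2).mul (i4.pow 2)).mul i5)).add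
        (inV_ofNat_mul 72 ((h0.mul (i4.pow 2)).mul (i5.pow 2)))).hasTop_zero
        (by simp) (by simp) (by simp)
    have t5 : HasTop 3 4 (-(720 * (X 3 * X 4 ^ 3 * X 5 ^ 2)) : MvPolynomial (Fin 6) k) 0 :=
      (inV_ofNat_mul 720 ((h3.mul (i4.pow 3)).mul (i5.pow 2))).neg.hasTop_zero
        (by simp) (by simp) (by simp)
    have t6 : HasTop 3 4 (720 * (X 4 ^ 4 * X 5 ^ 3) : MvPolynomial (Fin 6) k) 720 := by
      simpa using ((h4.pow 4).mul (h5.pow 3)).ofNat_mul 720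
    refine HasTop.congr (((((((t0.C_mul _).add (t1.C_mul _)).add (t2.C_mul _)).add
      (t3.C_mul _)).add (t4.C_mul _)).add (t5.C_mul _)).add (t6.C_mul _)) ?_
    simp [Nat.factorial]
    field_simp
  · rw [hφ.apply_eq (N := 2) (by
      simp only [Function.iterate_succ_apply, Function.iterate_zero_apply, Del'_X3,
        iterate_Del'_X3_two])]
    simp only [Finset.sum_range_succ, Finset.sum_range_zero, zero_add,
      Function.iterate_succ_apply, Function.iterate_zero_apply, Del'_X3]
    have t0 : HasTop 1 1 (X 3 : MvPolynomial (Fin 6) k) 0 :=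
      h3.hasTop_zero le_rfl (by simp) (by simp)
    have t1 : HasTop 1 1 (-(X 4 * X 5) : MvPolynomial (Fin 6) k) (-1) := by
      simpa using (h4.mul h5).neg
    refine HasTop.congr ((t0.C_mul _).add (t1.C_mul _)) ?_
    simp [Nat.factorial]
  · rw [hφ.apply_eq (N := 1) (by simp only [Function.iterate_one, Del'_X4])]
    simpa using h4
  · rw [hφ.apply_eq (N := 1) (by simp only [Function.iterate_one, Del'_X5])]
    simpa using h5

/-- The general combination of the monomials `x3^2, x2x3, x2^2, x1x2, x1^2, x3, x2, x1, t_f, 1`. -/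
def quadForm (q33 q23 q22 q12 q11 l3 l2 l1 c e : k) : MvPolynomial (Fin 6) k :=
  C q33 * X 2 ^ 2 + C q23 * (X 1 * X 2) + C q22 * X 1 ^ 2 + C q12 * (X 0 * X 1) +
    C q11 * X 0 ^ 2 + C l3 * X 2 + C l2 * X 1 + C l1 * X 0 + C c * X 4 + C e

section Tops

variable {u : k} {φ : MvPolynomial (Fin 6) k →ₐ[k] MvPolynomial (Fin 6) k}
  {q33 q23 q22 q12 q11 l3 l2 l1 c e : k}

lemma ExpTops.quadForm (H : ExpTops u φ) {M N : ℕ}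
    (h33 : q33 = 0 ∨ 6 ≤ M ∧ 8 ≤ N) (h23 : q23 = 0 ∨ 5 ≤ M ∧ 7 ≤ N)
    (h22 : q22 = 0 ∨ 4 ≤ M ∧ 6 ≤ N) (h12 : q12 = 0 ∨ 3 ≤ M ∧ 5 ≤ N)
    (h11 : q11 = 0 ∨ 2 ≤ M ∧ 4 ≤ N) (h3 : l3 = 0 ∨ 3 ≤ M ∧ 4 ≤ N)
    (h2 : l2 = 0 ∨ 2 ≤ M ∧ 3 ≤ N) (h1 : l1 = 0 ∨ 1 ≤ M ∧ 2 ≤ N)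
    (hc : c = 0 ∨ 0 ≤ M ∧ 1 ≤ N) :
    HasTop M N (φ (quadForm q33 q23 q22 q12 q11 l3 l2 l1 c e))
      ((if 6 = M ∧ 8 = N then q33 * (u ^ 6) ^ 2 else 0) +
        (if 5 = M ∧ 7 = N then q23 * (-u ^ 4 * u ^ 6) else 0) +
        (if 4 = M ∧ 6 = N then q22 * (-u ^ 4) ^ 2 else 0) +
        (if 3 = M ∧ 5 = N then q12 * (u ^ 2 * -u ^ 4) else 0) +
        (if 2 = M ∧ 4 = N then q11 * (u ^ 2) ^ 2 else 0) +
        (if 3 = M ∧ 4 = N then l3 * u ^ 6 else 0) +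
        (if 2 = M ∧ 3 = N then l2 * -u ^ 4 else 0) +
        (if 1 = M ∧ 2 = N then l1 * u ^ 2 else 0) +
        (if 0 = M ∧ 1 = N then c * 1 else 0) +
        (if 0 = M ∧ 0 = N then e * 1 else 0)) := by
  have hφ : φ (YasudaPaper.quadForm q33 q23 q22 q12 q11 l3 l2 l1 c e) =
      C q33 * φ (X 2) ^ 2 + C q23 * (φ (X 1) * φ (X 2)) + C q22 * φ (X 1) ^ 2 +
      C q12 * (φ (X 0) * φ (X 1)) + C q11 * φ (X 0) ^ 2 + C l3 * φ (X 2) + C l2 * φ (X 1) +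
      C l1 * φ (X 0) + C c * φ (X 4) + C e * C 1 := by
    simp [YasudaPaper.quadForm, algHom_C, algebraMap_eq]
  rw [hφ]
  exact ((((((((((H.x2.pow 2).C_mul_of q33 h33).add ((H.x1.mul H.x2).C_mul_of q23 h23)).add
    ((H.x1.pow 2).C_mul_of q22 h22)).add ((H.x0.mul H.x1).C_mul_of q12 h12)).add
    ((H.x0.pow 2).C_mul_of q11 h11)).add (H.x2.C_mul_of l3 h3)).add (H.x1.C_mul_of l2 h2)).add
    (H.x0.C_mul_of l1 h1)).add (H.f.C_mul_of c hc)).add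
    ((hasTop_C 1).C_mul_of e (Or.inr ⟨M.zero_le, N.zero_le⟩))

lemma ExpTops.quadForm_q33 (H : ExpTops u φ) :
    HasTop 6 8 (φ (YasudaPaper.quadForm q33 q23 q22 q12 q11 l3 l2 l1 c e)) (q33 * u ^ 12) :=
  (H.quadForm (by simp) (by simp) (by simp) (by simp) (by simp) (by simp) (by simp) (by simp)
    (by simp)).congr (by simp; left; ring)

lemma ExpTops.quadForm_q23 (H : ExpTops u φ) :
    HasTop 5 7 (φ (YasudaPaper.quadForm 0 q23 q22 q12 q11 l3 l2 l1 c e)) (-q23 * u ^ 10) :=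
  (H.quadForm (by simp) (by simp) (by simp) (by simp) (by simp) (by simp) (by simp) (by simp)
    (by simp)).congr (by simp; left; ring)

lemma ExpTops.quadForm_q22 (H : ExpTops u φ) :
    HasTop 4 6 (φ (YasudaPaper.quadForm 0 0 q22 q12 q11 l3 l2 l1 c e)) (q22 * u ^ 8) :=
  (H.quadForm (by simp) (by simp) (by simp) (by simp) (by simp) (by simp) (by simp) (by simp)
    (by simp)).congr (by simp; left; ring)

lemma ExpTops.quadForm_q12 (H : ExpTops u φ) :
    HasTop 3 5 (φ (YasudaPaper.quadForm 0 0 0 q12 q11 l3 l2 l1 c e)) (-q12 * u ^ 6) :=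
  (H.quadForm (by simp) (by simp) (by simp) (by simp) (by simp) (by simp) (by simp) (by simp)
    (by simp)).congr (by simp; left; ring)

lemma ExpTops.quadForm_l3 (H : ExpTops u φ) :
    HasTop 3 4 (φ (YasudaPaper.quadForm 0 0 0 0 q11 l3 l2 l1 c e)) (l3 * u ^ 6) :=
  (H.quadForm (by simp) (by simp) (by simp) (by simp) (by simp) (by simp) (by simp) (by simp)
    (by simp)).congr (by simp)

lemma ExpTops.quadForm_q11 (H : ExpTops u φ) :
    HasTop 2 4 (φ (YasudaPaper.quadForm 0 0 0 0 q11 0 l2 l1 c e)) (q11 * u ^ 4) :=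
  (H.quadForm (by simp) (by simp) (by simp) (by simp) (by simp) (by simp) (by simp) (by simp)
    (by simp)).congr (by simp; left; ring)

lemma ExpTops.quadForm_l2 (H : ExpTops u φ) :
    HasTop 2 3 (φ (YasudaPaper.quadForm 0 0 0 0 0 0 l2 l1 c e)) (-l2 * u ^ 4) :=
  (H.quadForm (by simp) (by simp) (by simp) (by simp) (by simp) (by simp) (by simp) (by simp)
    (by simp)).congr (by simp)

lemma ExpTops.quadForm_l1 (H : ExpTops u φ) :
    HasTop 1 2 (φ (YasudaPaper.quadForm 0 0 0 0 0 0 0 l1 c e)) (l1 * u ^ 2) :=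
  (H.quadForm (by simp) (by simp) (by simp) (by simp) (by simp) (by simp) (by simp) (by simp)
    (by simp)).congr (by simp)

lemma ExpTops.quadForm_c (H : ExpTops u φ) :
    HasTop 0 1 (φ (YasudaPaper.quadForm 0 0 0 0 0 0 0 0 c e)) c :=
  (H.quadForm (by simp) (by simp) (by simp) (by simp) (by simp) (by simp) (by simp) (by simp)
    (by simp)).congr (by simp)

end Tops

lemma affImg_eq (A : Matrix (Fin 3) (Fin 3) k) (d : Fin 3 → k) (j : Fin 3) :
    affImg A d j = C (A 0 j) * X 0 + C (A 1 j) * X 1 + C (A 2 j) * X 2 + C (d j) := by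
  rw [affImg, Fin.sum_univ_three]
  rfl

lemma affImg_eq_quadForm (A : Matrix (Fin 3) (Fin 3) k) (d : Fin 3 → k) (j : Fin 3) :
    affImg A d j = quadForm 0 0 0 0 0 (A 2 j) (A 1 j) (A 0 j) 0 (d j) := by
  rw [affImg_eq, quadForm]
  simp only [C_0]
  ring

lemma hatTf_eq_quadForm (A : Matrix (Fin 3) (Fin 3) k) (d : Fin 3 → k) :
    hatTf A d = quadForm (A 2 0 * A 2 2 - A 2 1 ^ 2)
      (A 1 0 * A 2 2 + A 2 0 * A 1 2 - 2 * (A 1 1 * A 2 1))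
      (A 1 0 * A 1 2 - A 1 1 ^ 2 + (A 0 0 * A 2 2 - 2 * (A 0 1 * A 2 1) + A 0 2 * A 2 0))
      (A 0 0 * A 1 2 + A 1 0 * A 0 2 - 2 * (A 0 1 * A 1 1))
      (A 0 0 * A 0 2 - A 0 1 ^ 2)
      (d 0 * A 2 2 + d 2 * A 2 0 - 2 * (d 1 * A 2 1))
      (d 0 * A 1 2 + d 2 * A 1 0 - 2 * (d 1 * A 1 1))
      (d 0 * A 0 2 + d 2 * A 0 0 - 2 * (d 1 * A 0 1))
      (A 0 0 * A 2 2 - 2 * (A 0 1 * A 2 1) + A 0 2 * A 2 0)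
      (d 0 * d 2 - d 1 ^ 2) := by
  simp only [hatTf, affImg_eq, quadForm, C_add, C_sub, C_mul, C_pow, map_ofNat]
  ring

lemma hasTop_affImg {u : k} {φ : MvPolynomial (Fin 6) k →ₐ[k] MvPolynomial (Fin 6) k}
    (H : ExpTops u φ) (A : Matrix (Fin 3) (Fin 3) k) (d : Fin 3 → k) (j : Fin 3) :
    HasTop 3 4 (φ (affImg A d j)) (A 2 j * u ^ 6) := by
  rw [affImg_eq_quadForm]
  exact H.quadForm_l3

/-- The image `y2 * F + y1 ^ 2` of `t_r` under `hatLift`. -/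
def hatTr (A : Matrix (Fin 3) (Fin 3) k) (d : Fin 3 → k) : MvPolynomial (Fin 6) k :=
  affImg A d 1 * hatTf A d + affImg A d 0 ^ 2

/-- The image `y3 * F ^ 2 + 2 * y1 * y2 * F + y1 ^ 3` of `t_g` under `hatLift`. -/
def hatTg (A : Matrix (Fin 3) (Fin 3) k) (d : Fin 3 → k) : MvPolynomial (Fin 6) k :=
  affImg A d 2 * hatTf A d ^ 2 + 2 * affImg A d 0 * affImg A d 1 * hatTf A d + affImg A d 0 ^ 3

lemma piMap_X : (∀ j : Fin 3, piMap (X (ι36 j) : MvPolynomial (Fin 6) k) = X j) ∧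
    piMap (X 3 : MvPolynomial (Fin 6) k) = rP ∧ piMap (X 4 : MvPolynomial (Fin 6) k) = fP ∧
    piMap (X 5 : MvPolynomial (Fin 6) k) = gP := by
  refine ⟨fun j => ?_, ?_, ?_, ?_⟩
  · fin_cases j <;> simp [piMap, ι36]
  all_goals simp [piMap]

/-- Some lift of `α` followed by `φ` maps `P_{γ,δ}` into a set `P_{γ',δ'}` with `γ' ≥ γ` and
`δ' ≥ δ`. -/
def LiftsInto (φ : MvPolynomial (Fin 6) k →ₐ[k] MvPolynomial (Fin 6) k)
    (α : MvPolynomial (Fin 3) k ≃ₐ[k] MvPolynomial (Fin 3) k) (γ δ : ℕ) : Prop :=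
  ∃ γ' δ' : ℕ, γ ≤ γ' ∧ δ ≤ δ' ∧
    ∃ α' : MvPolynomial (Fin 6) k →ₐ[k] MvPolynomial (Fin 6) k,
      IsLift α α' ∧ ∀ p ∈ Pset γ δ, φ (α' p) ∈ Pset γ' δ'

section Lift

variable {A : Matrix (Fin 3) (Fin 3) k} {d : Fin 3 → k}
  {α : MvPolynomial (Fin 3) k ≃ₐ[k] MvPolynomial (Fin 3) k}

lemma piMap_affImg (hA : ∀ i : Fin 3, α (X i) = (∑ j : Fin 3, C (A j i) * X j) + C (d i))
    (j : Fin 3) : piMap (affImg A d j) = α (X j) := by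
  simp only [affImg, hA, map_add, map_sum, map_mul, piMap_X.1, algHom_C, algebraMap_eq]

lemma piMap_hatTf (hA : ∀ i : Fin 3, α (X i) = (∑ j : Fin 3, C (A j i) * X j) + C (d i)) :
    piMap (hatTf A d) = α fP := by
  have hf : piMap (X 4 - (X 0 * X 2 - X 1 ^ 2) : MvPolynomial (Fin 6) k) = 0 := by
    simp [piMap, fP]
  rw [hatTf, map_add, map_mul, hf, mul_zero, add_zero, fP]
  simp only [map_sub, map_mul, map_pow, piMap_affImg hA]

lemma piMap_hatTr (hA : ∀ i : Fin 3, α (X i) = (∑ j : Fin 3, C (A j i) * X j) + C (d i)) :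
    piMap (hatTr A d) = α rP := by
  simp only [hatTr, rP, map_add, map_mul, map_pow, piMap_affImg hA, piMap_hatTf hA]

lemma piMap_hatTg (hA : ∀ i : Fin 3, α (X i) = (∑ j : Fin 3, C (A j i) * X j) + C (d i)) :
    piMap (hatTg A d) = α gP := by
  simp only [hatTg, gP, map_add, map_mul, map_pow, piMap_affImg hA, piMap_hatTf hA, map_ofNat]

/-- A lift with suitably bounded values composes with `φ` to a map between the sets `P_{γ,δ}`. -/
lemma exists_lift (hA : ∀ i : Fin 3, α (X i) = (∑ j : Fin 3, C (A j i) * X j) + C (d i))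
    {φ : MvPolynomial (Fin 6) k →ₐ[k] MvPolynomial (Fin 6) k} {R G : MvPolynomial (Fin 6) k}
    (hR : piMap R = α rP) (hG : piMap G = α gP) {m5 n5 m6 n6 : ℕ} {c4 c5 : k}
    (h0 : InV m6 n6 (φ (affImg A d 0))) (h1 : InV (2 * m6) (2 * n6) (φ (affImg A d 1)))
    (h2 : InV (3 * m6) (3 * n6) (φ (affImg A d 2))) (h3 : InV m6 n6 (φ R))
    (h4 : HasTop m5 n5 (φ (hatTf A d)) c4) (h5 : HasTop m6 (n6 + 1) (φ G) c5)
    (hn5 : 1 ≤ n5) (hm6 : 1 ≤ m6) (hc4 : c4 ≠ 0) (hc5 : c5 ≠ 0) (γ δ : ℕ) :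
    LiftsInto φ α γ δ := by
  refine ⟨m6 * γ + m5 * δ, (n6 + 1) * γ + n5 * δ, by nlinarith, by nlinarith,
    aeval ![affImg A d 0, affImg A d 1, affImg A d 2, R, hatTf A d, G], ⟨?_, ?_⟩, ?_⟩
  · have hi : ∀ i : Fin 3, embP (α (X i)) = affImg A d i := fun i => by
      simp [hA, embP, affImg]
    intro i
    rw [hi]
    fin_cases i <;> simp [ι36]
  · intro p
    have hcomp : piMap.comp (aeval ![affImg A d 0, affImg A d 1, affImg A d 2, R, hatTf A d, G]) =
        (α : _ →ₐ[k] _).comp piMap := by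
      refine algHom_ext fun i => ?_
      fin_cases i
      · simpa [piMap] using piMap_affImg hA 0
      · simpa [piMap] using piMap_affImg hA 1
      · simpa [piMap] using piMap_affImg hA 2
      · simpa [piMap] using hR
      · simpa [piMap] using piMap_hatTf hA
      · simpa [piMap] using hG
    exact DFunLike.congr_fun hcomp p
  · intro p hp
    have := image_mem_Pset (φ.comp
      (aeval ![affImg A d 0, affImg A d 1, affImg A d 2, R, hatTf A d, G])) (m5 := m5) (n5 := n5)
      (m6 := m6) (n6 := n6) (c4 := c4) (c5 := c5) (by simpa using h0) (by simpa using h1)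
      (by simpa using h2) (by simpa using h3) (by simpa using h4) (by simpa using h5) hn5 hc4 hc5 hp
    simpa using this

end Lift

section HatLift

variable {A : Matrix (Fin 3) (Fin 3) k} {d : Fin 3 → k}
  {α : MvPolynomial (Fin 3) k ≃ₐ[k] MvPolynomial (Fin 3) k} {u : k}
  {φ : MvPolynomial (Fin 6) k →ₐ[k] MvPolynomial (Fin 6) k}

lemma exists_lift_hat (hA : ∀ i : Fin 3, α (X i) = (∑ j : Fin 3, C (A j i) * X j) + C (d i))
    (H : ExpTops u φ) {m5 n5 m6 n6 : ℕ} {c4 c5 : k} (h3 : InV m6 n6 (φ (hatTr A d)))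
    (h4 : HasTop m5 n5 (φ (hatTf A d)) c4) (h5 : HasTop m6 (n6 + 1) (φ (hatTg A d)) c5)
    (hn5 : 1 ≤ n5) (hm6 : 3 ≤ m6) (hn6 : 4 ≤ n6) (hc4 : c4 ≠ 0) (hc5 : c5 ≠ 0) (γ δ : ℕ) :
    LiftsInto φ α γ δ :=
  exists_lift hA (piMap_hatTr hA) (piMap_hatTg hA)
    ((hasTop_affImg H A d 0).inV.mono (by omega) (by omega))
    ((hasTop_affImg H A d 1).inV.mono (by omega) (by omega))
    ((hasTop_affImg H A d 2).inV.mono (by omega) (by omega))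
    h3 h4 h5 hn5 (by omega) hc4 hc5 γ δ

/-- The lift `hatLift` works as soon as `y3 * F ^ 2` dominates the image of `t_g`. -/
lemma exists_lift_of_dominant
    (hA : ∀ i : Fin 3, α (X i) = (∑ j : Fin 3, C (A j i) * X j) + C (d i))
    (H : ExpTops u φ) {a0 b0 a1 b1 a2 b2 m n : ℕ} {c2 c4 : k}
    (h0 : InV a0 b0 (φ (affImg A d 0))) (h1 : InV a1 b1 (φ (affImg A d 1)))
    (h2 : HasTop a2 (b2 + 1) (φ (affImg A d 2)) c2) (h4 : HasTop m n (φ (hatTf A d)) c4)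
    (hc2 : c2 ≠ 0) (hc4 : c4 ≠ 0)
    (hm : a0 + a1 ≤ a2 + m ∧ a0 * 3 ≤ a2 + 2 * m ∧ a1 ≤ a2 + m ∧ 3 ≤ a2 + 2 * m)
    (hn : b0 + b1 ≤ b2 + n + 1 ∧ b0 * 3 ≤ b2 + 2 * n + 1 ∧ b0 * 2 ≤ b2 + 2 * n ∧
      b1 ≤ b2 + n ∧ 4 ≤ b2 + 2 * n)
    (hlt : a0 + a1 + (b0 + b1) < a2 + m + (b2 + n + 1) ∧
      a0 * 3 + b0 * 3 < a2 + 2 * m + (b2 + 2 * n + 1))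
    (hn1 : 1 ≤ n) (γ δ : ℕ) : LiftsInto φ α γ δ := by
  refine exists_lift_hat hA H (m6 := a2 + 2 * m) (n6 := b2 + 2 * n) (c5 := c2 * c4 ^ 2)
    ?_ h4 ?_ hn1 hm.2.2.2 hn.2.2.2.2 hc4 (mul_ne_zero hc2 (pow_ne_zero _ hc4)) γ δ
  · rw [hatTr, map_add, map_mul, map_pow]
    exact ((h1.mul h4.inV).mono (by omega) (by omega)).add
      ((h0.pow 2).mono (by omega) (by omega))
  · have e : φ (hatTg A d) = φ (affImg A d 2) * φ (hatTf A d) ^ 2 +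
        2 * (φ (affImg A d 0) * φ (affImg A d 1) * φ (hatTf A d)) + φ (affImg A d 0) ^ 3 := by
      simp only [hatTg, map_add, map_mul, map_pow, map_ofNat, mul_assoc]
    rw [e]
    have t1 := h2.mul (h4.pow 2)
    have t2 := (inV_ofNat_mul 2 ((h0.mul h1).mul h4.inV)).hasTop_zero
      (m' := a2 + m * 2) (n' := b2 + 1 + n * 2) (by omega) (by omega) (by omega)
    have t3 := (h0.pow 3).hasTop_zero
      (m' := a2 + m * 2) (n' := b2 + 1 + n * 2) (by omega) (by omega) (by omega)
    have := (t1.add t2).add t3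
    convert this using 1
    · ring
    · ring
    · ring

lemma exists_hasTop_affImg_two (H : ExpTops u φ) (hu : u ≠ 0) (hdet : A.det ≠ 0) :
    ∃ (a : ℕ) (c : k), c ≠ 0 ∧ 1 ≤ a ∧ a ≤ 3 ∧ (a = 1 → A 1 2 = 0 ∧ A 2 2 = 0) ∧
      HasTop a (a + 1) (φ (affImg A d 2)) c := by
  rw [affImg_eq_quadForm]
  by_cases h2 : A 2 2 = 0
  · rw [h2]
    by_cases h1 : A 1 2 = 0
    · rw [h1]
      refine ⟨1, _, mul_ne_zero (fun h0 => hdet ?_) (pow_ne_zero _ hu), le_rfl, by omega,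
        fun _ => ⟨rfl, rfl⟩, H.quadForm_l1⟩
      rw [Matrix.det_fin_three, h0, h1, h2]
      ring
    · exact ⟨2, _, mul_ne_zero (neg_ne_zero.2 h1) (pow_ne_zero _ hu), by omega, by omega,
        by omega, H.quadForm_l2⟩
  · exact ⟨3, _, mul_ne_zero h2 (pow_ne_zero _ hu), by omega, by omega, by omega, H.quadForm_l3⟩

/-- The lift `hatLift` works when `F` involves one of `x3^2`, `x2x3`, `x2^2`. -/
lemma exists_lift_of_quadratic
    (hA : ∀ i : Fin 3, α (X i) = (∑ j : Fin 3, C (A j i) * X j) + C (d i))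
    (H : ExpTops u φ) (hu : u ≠ 0) (hdet : A.det ≠ 0)
    (hq : ¬ (A 2 0 * A 2 2 - A 2 1 ^ 2 = 0 ∧
      A 1 0 * A 2 2 + A 2 0 * A 1 2 - 2 * (A 1 1 * A 2 1) = 0 ∧
      A 1 0 * A 1 2 - A 1 1 ^ 2 + (A 0 0 * A 2 2 - 2 * (A 0 1 * A 2 1) + A 0 2 * A 2 0) = 0))
    (γ δ : ℕ) : LiftsInto φ α γ δ := by
  obtain ⟨a, c, hc, ha1, ha3, ha, h2⟩ := exists_hasTop_affImg_two (d := d) H hu hdet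
  have h0 := (hasTop_affImg H A d 0).inV
  have h1 := (hasTop_affImg H A d 1).inV
  have hF := hatTf_eq_quadForm A d
  by_cases q33 : A 2 0 * A 2 2 - A 2 1 ^ 2 = 0
  · rw [q33] at hF
    by_cases q23 : A 1 0 * A 2 2 + A 2 0 * A 1 2 - 2 * (A 1 1 * A 2 1) = 0
    · rw [q23] at hF
      have q22 := fun h => hq ⟨q33, q23, h⟩
      have h4 := hF ▸ H.quadForm_q22
      have hc4 := mul_ne_zero q22 (pow_ne_zero 8 hu)
      by_cases h : a = 1
      · subst h
        obtain ⟨h12, h22⟩ := ha rfl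
        have h21 : A 2 1 = 0 := by simpa [h22] using q33
        have h1' : InV 2 3 (φ (affImg A d 1)) := by
          rw [affImg_eq_quadForm, h21]
          exact H.quadForm_l2.inV
        exact exists_lift_of_dominant hA H h0 h1' h2 h4 hc hc4 (by omega) (by omega)
          (by omega) (by omega) γ δ
      · exact exists_lift_of_dominant hA H h0 h1 h2 h4 hc hc4 (by omega) (by omega)
          (by omega) (by omega) γ δ
    · exact exists_lift_of_dominant hA H h0 h1 h2 (hF ▸ H.quadForm_q23) hc
        (mul_ne_zero (neg_ne_zero.2 q23) (pow_ne_zero 10 hu)) (by omega) (by omega)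
        (by omega) (by omega) γ δ
  · exact exists_lift_of_dominant hA H h0 h1 h2 (hF ▸ H.quadForm_q33) hc
      (mul_ne_zero q33 (pow_ne_zero 12 hu)) (by omega) (by omega) (by omega) (by omega) γ δ

end HatLift

section Triangular

variable {A : Matrix (Fin 3) (Fin 3) k} {d : Fin 3 → k}
  {α : MvPolynomial (Fin 3) k ≃ₐ[k] MvPolynomial (Fin 3) k} {u : k}
  {φ : MvPolynomial (Fin 6) k →ₐ[k] MvPolynomial (Fin 6) k}

/-- A lift for `α = (v^3 x1, q v^2 x1 + v^2 x2, q^2 v x1 + 2 q v x2 + v x3)` with `q ≠ 0`. -/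
lemma exists_lift_of_unipotent {v q : k} (H : ExpTops u φ) (hu : u ≠ 0) (hv : v ≠ 0) (hq : q ≠ 0)
    (hA : ∀ i : Fin 3, α (X i) = (∑ j : Fin 3, C (A j i) * X j) + C (d i))
    (h00 : A 0 0 = v ^ 3) (h01 : A 0 1 = q * v ^ 2) (h02 : A 0 2 = q ^ 2 * v)
    (h10 : A 1 0 = 0) (h11 : A 1 1 = v ^ 2) (h12 : A 1 2 = 2 * q * v)
    (h20 : A 2 0 = 0) (h21 : A 2 1 = 0) (h22 : A 2 2 = v)
    (hd0 : d 0 = 0) (hd1 : d 1 = 0) (hd2 : d 2 = 0) (γ δ : ℕ) : LiftsInto φ α γ δ := by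
  have a0 : α (X 0) = C v ^ 3 * X 0 := by
    simp [hA, Fin.sum_univ_three, h00, h10, h20, hd0]
  have a1 : α (X 1) = C q * C v ^ 2 * X 0 + C v ^ 2 * X 1 := by
    simp [hA, Fin.sum_univ_three, h01, h11, h21, hd1]
  have a2 : α (X 2) = C q ^ 2 * C v * X 0 + 2 * C q * C v * X 1 + C v * X 2 := by
    simp [hA, Fin.sum_univ_three, h02, h12, h22, hd2, map_ofNat C 2]
  have hR : piMap (C (v ^ 6) * X 3 + C (q * v ^ 6) * (X 0 * X 4)) = α rP := by
    simp only [rP, fP, map_add, map_mul, map_pow, map_sub, a0, a1, a2, piMap_X.2.1,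
      piMap_X.2.2.1, algHom_C, algebraMap_eq, show piMap (X 0 : MvPolynomial (Fin 6) k) = X 0
      from piMap_X.1 0]
    ring
  have hG : piMap (C (v ^ 9) * X 5 + C (2 * q * v ^ 9) * (X 4 * X 3) +
      C (q ^ 2 * v ^ 9) * (X 0 * X 4 ^ 2)) = α gP := by
    simp only [gP, rP, fP, map_add, map_mul, map_pow, map_sub, a0, a1, a2, piMap_X.2.1,
      piMap_X.2.2.1, piMap_X.2.2.2, algHom_C, algebraMap_eq, map_ofNat,
      show piMap (X 0 : MvPolynomial (Fin 6) k) = X 0 from piMap_X.1 0]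
    ring
  have hF : hatTf A d = quadForm 0 0 0 0 0 0 0 0 (v ^ 3 * v) 0 := by
    rw [hatTf_eq_quadForm, h00, h01, h02, h10, h11, h12, h20, h21, h22, hd0, hd1, hd2]
    congr 1 <;> ring
  refine exists_lift hA hR hG (m5 := 0) (n5 := 1) (m6 := 1) (n6 := 3) (c4 := v ^ 3 * v)
    (c5 := q ^ 2 * v ^ 9 * (u ^ 2 * 1 ^ 2)) ?_ ?_ ?_ ?_ ?_ ?_ le_rfl le_rfl
    (mul_ne_zero (pow_ne_zero _ hv) hv)
    (mul_ne_zero (mul_ne_zero (pow_ne_zero _ hq) (pow_ne_zero _ hv)) (by simpa using hu)) γ δ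
  · rw [affImg_eq_quadForm, h10, h20]
    exact H.quadForm_l1.inV.mono (by omega) (by omega)
  · rw [affImg_eq_quadForm, h21]
    exact H.quadForm_l2.inV.mono (by omega) (by omega)
  · exact (hasTop_affImg H A d 2).inV.mono (by omega) (by omega)
  · simp only [map_add, map_mul, map_pow]
    have t1 := (H.r.inV.C_mul (v ^ 6)).mono (m' := 1) (n' := 3) (by omega) (by omega)
    have t2 := ((H.x0.inV.mul H.f.inV).C_mul (q * v ^ 6)).mono (m' := 1) (n' := 3)
      (by omega) (by omega)
    simpa [algHom_C, algebraMap_eq] using t1.add t2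
  · exact hF ▸ H.quadForm_c
  · simp only [map_add, map_mul, map_pow]
    have t1 := (H.g.C_mul (v ^ 9)).of_lt (m' := 1) (n' := 4) (by omega) (by omega) (by omega)
    have t2 := ((H.f.mul H.r).C_mul (2 * q * v ^ 9)).of_lt (m' := 1) (n' := 4)
      (by omega) (by omega) (by omega)
    have t3 := (H.x0.mul (H.f.pow 2)).C_mul (q ^ 2 * v ^ 9)
    simpa [algHom_C, algebraMap_eq] using (t1.add t2).add t3

/-- A lift for the non-`B` affine automorphisms preserving the flag of `x1`, `x2`, `x3`. -/
lemma exists_lift_of_triangular [CharZero k]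
    (hA : ∀ i : Fin 3, α (X i) = (∑ j : Fin 3, C (A j i) * X j) + C (d i))
    (H : ExpTops u φ) (hu : u ≠ 0) (hαB : α ∉ BSet)
    (h10 : A 1 0 = 0) (h20 : A 2 0 = 0) (h21 : A 2 1 = 0)
    (h00 : A 0 0 ≠ 0) (h11 : A 1 1 ≠ 0) (h22 : A 2 2 ≠ 0)
    (hsq : A 0 0 * A 2 2 = A 1 1 ^ 2) (γ δ : ℕ) : LiftsInto φ α γ δ := by
  have y0 : HasTop 1 2 (φ (affImg A d 0)) (A 0 0 * u ^ 2) := by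
    rw [affImg_eq_quadForm, h10, h20]
    exact H.quadForm_l1
  have y1 : HasTop 2 3 (φ (affImg A d 1)) (-A 1 1 * u ^ 4) := by
    rw [affImg_eq_quadForm, h21]
    exact H.quadForm_l2
  have y2 := hasTop_affImg H A d 2
  have hy2 := mul_ne_zero h22 (pow_ne_zero 6 hu)
  have hF : hatTf A d = quadForm 0 0 0 (A 0 0 * A 1 2 - 2 * (A 0 1 * A 1 1))
      (A 0 0 * A 0 2 - A 0 1 ^ 2) (d 0 * A 2 2) (d 0 * A 1 2 - 2 * (d 1 * A 1 1))
      (d 0 * A 0 2 + d 2 * A 0 0 - 2 * (d 1 * A 0 1)) (A 0 0 * A 2 2) (d 0 * d 2 - d 1 ^ 2) := by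
    rw [hatTf_eq_quadForm, h10, h20, h21]
    congr 1 <;> first | ring1 | linear_combination hsq
  have dom : ∀ {m n : ℕ} {c : k}, HasTop m n (φ (hatTf A d)) c → c ≠ 0 → 1 ≤ m → 2 ≤ n →
      LiftsInto φ α γ δ := fun h4 hc hm hn =>
    exists_lift_of_dominant hA H y0.inV y1.inV y2 h4 hy2 hc (by omega) (by omega)
      (by omega) (by omega) γ δ
  by_cases q12 : A 0 0 * A 1 2 - 2 * (A 0 1 * A 1 1) = 0
  swap
  · exact dom (hF ▸ H.quadForm_q12) (mul_ne_zero (neg_ne_zero.2 q12) (pow_ne_zero _ hu))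
      (by omega) (by omega)
  rw [q12] at hF
  by_cases l3 : d 0 * A 2 2 = 0
  swap
  · exact dom (hF ▸ H.quadForm_l3) (mul_ne_zero l3 (pow_ne_zero _ hu)) (by omega) (by omega)
  rw [l3] at hF
  by_cases q11 : A 0 0 * A 0 2 - A 0 1 ^ 2 = 0
  swap
  · exact dom (hF ▸ H.quadForm_q11) (mul_ne_zero q11 (pow_ne_zero _ hu)) (by omega) (by omega)
  rw [q11] at hF
  by_cases l2 : d 0 * A 1 2 - 2 * (d 1 * A 1 1) = 0
  swap
  · exact dom (hF ▸ H.quadForm_l2) (mul_ne_zero (neg_ne_zero.2 l2) (pow_ne_zero _ hu))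
      (by omega) (by omega)
  rw [l2] at hF
  by_cases l1 : d 0 * A 0 2 + d 2 * A 0 0 - 2 * (d 1 * A 0 1) = 0
  swap
  · exact dom (hF ▸ H.quadForm_l1) (mul_ne_zero l1 (pow_ne_zero _ hu)) (by omega) (by omega)
  rw [l1] at hF
  have h4 : HasTop 0 1 (φ (hatTf A d)) (A 0 0 * A 2 2) := hF ▸ H.quadForm_c
  have hc := mul_ne_zero h00 h22
  by_cases hg : A 2 2 ^ 3 - 2 * A 1 1 * A 2 2 + A 0 0 = 0
  · have e1 : A 1 1 = A 2 2 ^ 2 := by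
      have : (A 1 1 - A 2 2 ^ 2) ^ 2 = 0 := by linear_combination A 2 2 * hg - hsq
      exact sub_eq_zero.1 (pow_eq_zero_iff two_ne_zero |>.1 this)
    have e0 : A 0 0 = A 2 2 ^ 3 := by rw [e1] at hg; linear_combination hg
    have d0 : d 0 = 0 := by simpa [h22] using l3
    have d1 : d 1 = 0 := by simpa [d0, h11] using l2
    have d2 : d 2 = 0 := by simpa [d0, d1, h00] using l1
    obtain ⟨q, hq⟩ : ∃ q, A 0 1 = q * A 2 2 ^ 2 := ⟨A 0 1 / A 2 2 ^ 2, by field_simp⟩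
    have e12 : A 1 2 = 2 * q * A 2 2 := by
      apply mul_left_cancel₀ h00
      rw [e1, hq] at q12
      rw [e0] at q12 ⊢
      linear_combination q12
    have e02 : A 0 2 = q ^ 2 * A 2 2 := by
      apply mul_left_cancel₀ h00
      rw [hq] at q11
      rw [e0] at q11 ⊢
      linear_combination q11
    refine exists_lift_of_unipotent H hu h22 (fun hq0 => hαB ?_) hA e0 hq e02 h10 e1 e12 h20 h21
      rfl d0 d1 d2 γ δ
    subst hq0
    refine ⟨A 2 2, h22, ?_, ?_, ?_⟩ <;>
      simp [hA, Fin.sum_univ_three, e0, e1, hq, e02, e12, h10, h20, h21, d0, d1, d2]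
  · have hG : φ (hatTg A d) = φ (affImg A d 2) * φ (hatTf A d) ^ 2 +
        2 * (φ (affImg A d 0) * φ (affImg A d 1) * φ (hatTf A d)) + φ (affImg A d 0) ^ 3 := by
      simp only [hatTg, map_add, map_mul, map_pow, map_ofNat, mul_assoc]
    refine exists_lift_hat hA H (m6 := 3) (n6 := 5)
      (c5 := u ^ 6 * A 0 0 ^ 2 * (A 2 2 ^ 3 - 2 * A 1 1 * A 2 2 + A 0 0)) ?_ h4 ?_ le_rfl le_rfl
      (by omega) hc (mul_ne_zero (mul_ne_zero (pow_ne_zero _ hu) (pow_ne_zero _ h00)) hg) γ δ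
    · rw [hatTr, map_add, map_mul, map_pow]
      exact ((y1.mul h4).inV.mono (by omega) (by omega)).add
        ((y0.pow 2).inV.mono (by omega) (by omega))
    · rw [hG]
      refine (((y2.mul (h4.pow 2)).add (((y0.mul y1).mul h4).ofNat_mul 2)).add
        (y0.pow 3)).congr ?_
      simp only [OfNat.ofNat]
      ring

end Triangular

section Shear

variable {A : Matrix (Fin 3) (Fin 3) k} {d : Fin 3 → k}
  {α : MvPolynomial (Fin 3) k ≃ₐ[k] MvPolynomial (Fin 3) k} {u : k}
  {φ : MvPolynomial (Fin 6) k →ₐ[k] MvPolynomial (Fin 6) k}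

lemma ExpTops.exists_hasTop_quadForm (H : ExpTops u φ) (hu : u ≠ 0)
    {q12 q11 l3 l2 l1 c e : k} (hc : c ≠ 0) :
    ∃ (m n : ℕ) (a : k), m ≤ 3 ∧ 1 ≤ n ∧ n ≤ 5 ∧ a ≠ 0 ∧
      HasTop m n (φ (YasudaPaper.quadForm 0 0 0 q12 q11 l3 l2 l1 c e)) a := by
  by_cases h12 : q12 = 0
  swap
  · exact ⟨3, 5, _, le_rfl, by omega, le_rfl,
      mul_ne_zero (neg_ne_zero.2 h12) (pow_ne_zero _ hu), H.quadForm_q12⟩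
  subst h12
  by_cases h3 : l3 = 0
  swap
  · exact ⟨3, 4, _, le_rfl, by omega, by omega, mul_ne_zero h3 (pow_ne_zero _ hu), H.quadForm_l3⟩
  subst h3
  by_cases h11 : q11 = 0
  swap
  · exact ⟨2, 4, _, by omega, by omega, by omega, mul_ne_zero h11 (pow_ne_zero _ hu),
      H.quadForm_q11⟩
  subst h11
  by_cases h2 : l2 = 0
  swap
  · exact ⟨2, 3, _, by omega, by omega, by omega,
      mul_ne_zero (neg_ne_zero.2 h2) (pow_ne_zero _ hu), H.quadForm_l2⟩
  subst h2
  by_cases h1 : l1 = 0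
  swap
  · exact ⟨1, 2, _, by omega, by omega, by omega, mul_ne_zero h1 (pow_ne_zero _ hu),
      H.quadForm_l1⟩
  subst h1
  exact ⟨0, 1, c, by omega, le_rfl, by omega, hc, H.quadForm_c⟩

section Identities

variable {t : k} {z2 z3 : MvPolynomial (Fin 6) k}

lemma hatTr_eq (h1 : affImg A d 1 = z2 + C t * affImg A d 0) :
    hatTr A d = affImg A d 0 * (C t * hatTf A d + affImg A d 0) + z2 * hatTf A d := by
  rw [hatTr, h1]
  ring

lemma hatTg_eq (h1 : affImg A d 1 = z2 + C t * affImg A d 0)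
    (h2 : affImg A d 2 = z3 + 2 * C t * z2 + C t ^ 2 * affImg A d 0) :
    hatTg A d = affImg A d 0 * (C t * hatTf A d + affImg A d 0) ^ 2 +
      2 * (z2 * hatTf A d * (C t * hatTf A d + affImg A d 0)) + z3 * hatTf A d ^ 2 := by
  rw [hatTg, h1, h2]
  ring

/-- The lift `hatLift` works as soon as `y1 * (t * F + y1) ^ 2` dominates the image of `t_g`. -/
lemma exists_lift_of_shear_dominant
    (hA : ∀ i : Fin 3, α (X i) = (∑ j : Fin 3, C (A j i) * X j) + C (d i))
    (H : ExpTops u φ) (hu : u ≠ 0) (hs : A 2 0 ≠ 0)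
    (h1 : affImg A d 1 = z2 + C t * affImg A d 0)
    (h2 : affImg A d 2 = z3 + 2 * C t * z2 + C t ^ 2 * affImg A d 0)
    (hz2 : InV 2 3 (φ z2)) (hz3 : InV 1 2 (φ z3)) {m n m5 n5 : ℕ} {w c4 : k}
    (hF : HasTop m5 n5 (φ (hatTf A d)) c4)
    (hW : HasTop m n (φ (C t * hatTf A d + affImg A d 0)) w) (hc4 : c4 ≠ 0) (hw : w ≠ 0)
    (hn5 : 1 ≤ n5) (hm : m5 ≤ 1 + m) (hn : n5 ≤ 1 + n ∧ 1 ≤ n) (hlt : m5 + n5 < 2 + m + n)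
    (γ δ : ℕ) : LiftsInto φ α γ δ := by
  have y0 := hasTop_affImg H A d 0
  refine exists_lift_hat hA H (m6 := 3 + m * 2) (n6 := 3 + n * 2) (c5 := A 2 0 * u ^ 6 * w ^ 2)
    ?_ hF ?_ hn5 (by omega) (by omega) hc4
    (mul_ne_zero (mul_ne_zero hs (pow_ne_zero _ hu)) (pow_ne_zero _ hw)) γ δ
  · rw [hatTr_eq h1, map_add, map_mul, map_mul _ z2]
    exact ((y0.inV.mul hW.inV).mono (by omega) (by omega)).add
      ((hz2.mul hF.inV).mono (by omega) (by omega))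
  · have e : φ (hatTg A d) = φ (affImg A d 0) * φ (C t * hatTf A d + affImg A d 0) ^ 2 +
        2 * (φ z2 * φ (hatTf A d) * φ (C t * hatTf A d + affImg A d 0)) +
        φ z3 * φ (hatTf A d) ^ 2 := by
      rw [hatTg_eq h1 h2]
      simp only [map_add, map_mul, map_pow, map_ofNat]
    rw [e]
    have t1 := y0.mul (hW.pow 2)
    have t2 := (inV_ofNat_mul 2 ((hz2.mul hF.inV).mul hW.inV)).hasTop_zero
      (m' := 3 + m * 2) (n' := 4 + n * 2) (by omega) (by omega) (by omega)
    have t3 := (hz3.mul (hF.inV.pow 2)).hasTop_zero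
      (m' := 3 + m * 2) (n' := 4 + n * 2) (by omega) (by omega) (by omega)
    convert (t1.add t2).add t3 using 1
    · ring
    · ring

/-- When `V = z2 - t * W` is linear in `x1`, the relation `π F = π (y1 * z3 - z2 ^ 2)` gives a
second preimage of `α g`, dominated by `F ^ 2`. -/
lemma exists_lift_of_shear_relation
    (hA : ∀ i : Fin 3, α (X i) = (∑ j : Fin 3, C (A j i) * X j) + C (d i))
    (H : ExpTops u φ) (ht : t ≠ 0)
    (h1 : affImg A d 1 = z2 + C t * affImg A d 0)
    (h2 : affImg A d 2 = z3 + 2 * C t * z2 + C t ^ 2 * affImg A d 0)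
    (hz3 : InV 1 2 (φ z3)) {c4 : k} (hF : HasTop 3 4 (φ (hatTf A d)) c4)
    (hW : InV 2 3 (φ (C t * hatTf A d + affImg A d 0)))
    (hV : InV 1 2 (φ (z2 - C t * (C t * hatTf A d + affImg A d 0)))) (hc4 : c4 ≠ 0)
    (γ δ : ℕ) : LiftsInto φ α γ δ := by
  have hFz : piMap (hatTf A d) = piMap (affImg A d 0) * piMap z3 - piMap z2 ^ 2 := by
    rw [piMap_hatTf hA, fP]
    simp only [map_sub, map_mul, map_pow, ← piMap_affImg hA]
    rw [h1, h2]
    simp only [map_add, map_mul, map_pow, map_ofNat]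
    ring
  set W := C t * hatTf A d + affImg A d 0 with hWdef
  set V := z2 - C t * W with hVdef
  set G := W ^ 2 * (z3 - 2 * (C t * V)) - hatTf A d * W - V ^ 2 * W - C t * hatTf A d ^ 2 -
    C t * (hatTf A d * V ^ 2) with hGdef
  have hpiG : piMap G = C (t ^ 2) * α gP := by
    rw [← piMap_hatTg hA, hatTg_eq h1 h2, hGdef, hVdef, hWdef]
    simp only [map_add, map_mul, map_pow, map_sub, map_ofNat, algHom_C, algebraMap_eq]
    generalize piMap (hatTf A d) = F at hFz ⊢
    generalize piMap (affImg A d 0) = y at hFz ⊢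
    generalize piMap z2 = x at hFz ⊢
    generalize piMap z3 = z at hFz ⊢
    subst hFz
    ring
  refine exists_lift hA (R := hatTr A d) (G := C (t ^ 2)⁻¹ * G) (m5 := 3) (n5 := 4) (m6 := 6)
    (n6 := 7) (c4 := c4) (c5 := (t ^ 2)⁻¹ * -(t * c4 ^ 2)) (piMap_hatTr hA) ?_
    ((hasTop_affImg H A d 0).inV.mono (by omega) (by omega))
    ((hasTop_affImg H A d 1).inV.mono (by omega) (by omega))
    ((hasTop_affImg H A d 2).inV.mono (by omega) (by omega)) ?_ hF ?_ (by omega) (by omega) hc4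
    (mul_ne_zero (inv_ne_zero (pow_ne_zero _ ht))
      (neg_ne_zero.2 (mul_ne_zero ht (pow_ne_zero _ hc4)))) γ δ
  · rw [map_mul, hpiG, algHom_C, algebraMap_eq, ← mul_assoc, ← C_mul,
      inv_mul_cancel₀ (pow_ne_zero _ ht), C_1, one_mul]
  · have e : hatTr A d = W ^ 2 + V * hatTf A d := by
      rw [hatTr_eq h1, hVdef, hWdef]
      ring
    rw [e, map_add, map_mul, map_pow]
    exact ((hW.pow 2).mono (by omega) (by omega)).add ((hV.mul hF.inV).mono (by omega) (by omega))
  · rw [map_mul, algHom_C, algebraMap_eq]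
    refine HasTop.C_mul ?_ _
    have e : φ G = φ W ^ 2 * (φ z3 - 2 * (C t * φ V)) - φ (hatTf A d) * φ W - φ V ^ 2 * φ W -
        C t * φ (hatTf A d) ^ 2 - C t * (φ (hatTf A d) * φ V ^ 2) := by
      rw [hGdef]
      simp only [map_sub, map_mul, map_pow, map_ofNat, algHom_C, algebraMap_eq]
    rw [e]
    have t1 := ((hW.pow 2).mul (hz3.sub (inV_ofNat_mul 2 (hV.C_mul t)))).hasTop_zero
      (m' := 6) (n' := 8) (by omega) (by omega) (by omega)
    have t2 := (hF.inV.mul hW).hasTop_zero (m' := 6) (n' := 8) (by omega) (by omega) (by omega)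
    have t3 := ((hV.pow 2).mul hW).hasTop_zero (m' := 6) (n' := 8) (by omega) (by omega) (by omega)
    have t4 := (hF.pow 2).C_mul t
    have t5 := ((hF.inV.mul (hV.pow 2)).C_mul t).hasTop_zero (m' := 6) (n' := 8)
      (by omega) (by omega) (by omega)
    exact ((((t1.sub t2).sub t3).sub t4).sub t5).congr (by ring)

end Identities
/-- A lift for the affine automorphisms with `A 2 0 ≠ 0` for which `F` involves none of `x3^2`,
`x2x3`, `x2^2`. -/
lemma exists_lift_of_shear [CharZero k] {s t q p m l a b e2 e3 : k}
    (hA : ∀ i : Fin 3, α (X i) = (∑ j : Fin 3, C (A j i) * X j) + C (d i))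
    (H : ExpTops u φ) (hu : u ≠ 0) (hs : s ≠ 0) (hp : p ≠ 0) (hsl : s * l = p ^ 2)
    (h00 : A 0 0 = a) (h01 : A 0 1 = m + t * a) (h02 : A 0 2 = l + 2 * t * m + t ^ 2 * a)
    (h10 : A 1 0 = q) (h11 : A 1 1 = p + t * q) (h12 : A 1 2 = 2 * t * p + t ^ 2 * q)
    (h20 : A 2 0 = s) (h21 : A 2 1 = t * s) (h22 : A 2 2 = t ^ 2 * s)
    (hd0 : d 0 = b) (hd1 : d 1 = e2 + t * b) (hd2 : d 2 = e3 + 2 * t * e2 + t ^ 2 * b)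
    (γ δ : ℕ) : LiftsInto φ α γ δ := by
  set z2 : MvPolynomial (Fin 6) k := quadForm 0 0 0 0 0 0 p m 0 e2 with hz2
  set z3 : MvPolynomial (Fin 6) k := quadForm 0 0 0 0 0 0 0 l 0 e3 with hz3
  have h0 : affImg A d 0 = quadForm 0 0 0 0 0 s q a 0 b := by
    rw [affImg_eq_quadForm, h00, h10, h20, hd0]
  have h1 : affImg A d 1 = z2 + C t * affImg A d 0 := by
    rw [h0, affImg_eq, h01, h11, h21, hd1, hz2]
    simp only [quadForm, C_add, C_mul, C_0]
    ring
  have h2 : affImg A d 2 = z3 + 2 * C t * z2 + C t ^ 2 * affImg A d 0 := by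
    rw [h0, affImg_eq, h02, h12, h22, hd2, hz2, hz3]
    simp only [quadForm, C_add, C_mul, C_0, C_pow, map_ofNat]
    ring
  obtain ⟨ρ, hρ⟩ : ∃ ρ, ρ = q * l - 2 * p * m := ⟨_, rfl⟩
  obtain ⟨κ, hκ⟩ : ∃ κ, κ = a * l - m ^ 2 := ⟨_, rfl⟩
  obtain ⟨ξ, hξ⟩ : ∃ ξ, ξ = s * e3 := ⟨_, rfl⟩
  obtain ⟨η, hη⟩ : ∃ η, η = q * e3 - 2 * p * e2 := ⟨_, rfl⟩
  obtain ⟨θ, hθ⟩ : ∃ θ, θ = a * e3 + b * l - 2 * m * e2 := ⟨_, rfl⟩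
  obtain ⟨c, hc⟩ : ∃ c, c = s * l := ⟨_, rfl⟩
  obtain ⟨e, he⟩ : ∃ e, e = b * e3 - e2 ^ 2 := ⟨_, rfl⟩
  have hF : hatTf A d = quadForm 0 0 0 ρ κ ξ η θ c e := by
    rw [hatTf_eq_quadForm, h00, h01, h02, h10, h11, h12, h20, h21, h22, hd0, hd1, hd2, hρ, hκ, hξ,
      hη, hθ, hc, he]
    congr 1 <;> first | ring1 | linear_combination hsl
  have hW : C t * hatTf A d + affImg A d 0 = quadForm 0 0 0 (t * ρ) (t * κ) (s + t * ξ)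
      (t * η + q) (t * θ + a) (t * c) (t * e + b) := by
    rw [hF, h0]
    simp only [quadForm, C_add, C_mul, C_0]
    ring
  have hc0 : c ≠ 0 := hc.trans hsl ▸ pow_ne_zero 2 hp
  have y0 := hasTop_affImg H A d 0
  rw [h20] at y0
  have tz2 : HasTop 2 3 (φ z2) (-p * u ^ 4) := H.quadForm_l2
  have tz3 : HasTop 1 2 (φ z3) (l * u ^ 2) := H.quadForm_l1
  have dom := @exists_lift_of_shear_dominant k _ A d α u φ t z2 z3 hA H hu (h20 ▸ hs) h1 h2
    tz2.inV tz3.inV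
  by_cases h_tρ : t * ρ = 0
  swap
  · have hρ0 := right_ne_zero_of_mul h_tρ
    exact dom (hF ▸ H.quadForm_q12) (hW ▸ H.quadForm_q12)
      (mul_ne_zero (neg_ne_zero.2 hρ0) (pow_ne_zero _ hu))
      (mul_ne_zero (neg_ne_zero.2 h_tρ) (pow_ne_zero _ hu)) (by omega) (by omega) (by omega)
      (by omega) γ δ
  rw [h_tρ] at hW
  by_cases h_sξ : s + t * ξ = 0
  swap
  · obtain ⟨m5, n5, c4, hm5, hn5, hn5', hc4, hF'⟩ := H.exists_hasTop_quadForm hu hc0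
      (q12 := ρ) (q11 := κ) (l3 := ξ) (l2 := η) (l1 := θ) (e := e)
    exact dom (hF ▸ hF') (hW ▸ H.quadForm_l3) hc4 (mul_ne_zero h_sξ (pow_ne_zero _ hu)) hn5
      (by omega) (by omega) (by omega) γ δ
  rw [h_sξ] at hW
  have ht : t ≠ 0 := by
    rintro rfl
    exact hs (by simpa using h_sξ)
  have hξ0 : ξ ≠ 0 := by
    intro h
    exact hs (by simpa [h] using h_sξ)
  obtain rfl : 0 = ρ := ((mul_eq_zero.1 h_tρ).resolve_left ht).symm
  have tF : HasTop 3 4 (φ (hatTf A d)) (ξ * u ^ 6) := hF ▸ H.quadForm_l3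
  have hcF := mul_ne_zero hξ0 (pow_ne_zero 6 hu)
  by_cases hκ0 : κ = 0
  swap
  · exact dom tF (hW ▸ H.quadForm_q11) hcF
      (mul_ne_zero (mul_ne_zero ht hκ0) (pow_ne_zero _ hu)) (by omega) (by omega) (by omega)
      (by omega) γ δ
  obtain ⟨w, hw⟩ : ∃ w, w = t * η + q := ⟨_, rfl⟩
  rw [hκ0, mul_zero, ← hw] at hW
  have tW : HasTop 2 3 (φ (C t * hatTf A d + affImg A d 0)) (-w * u ^ 4) := hW ▸ H.quadForm_l2
  by_cases hK : s * w ^ 2 + 2 * p * ξ * w + l * ξ ^ 2 = 0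
  · have hsw : s * w + p * ξ = 0 := by
      have : (s * w + p * ξ) ^ 2 = 0 := by linear_combination s * hK - ξ ^ 2 * hsl
      exact pow_eq_zero_iff two_ne_zero |>.1 this
    have htw : p - t * w = 0 := by
      apply mul_left_cancel₀ hs
      linear_combination p * h_sξ - t * hsw
    have hV : z2 - C t * (C t * hatTf A d + affImg A d 0) = quadForm 0 0 0 0 0 0 0
        (m - t * (t * θ + a)) (-t * (t * c)) (e2 - t * (t * e + b)) := by
      rw [hW, hz2, sub_eq_zero.1 htw]
      simp only [quadForm, C_add, C_sub, C_mul, C_neg, C_0]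
      ring
    exact exists_lift_of_shear_relation hA H ht h1 h2 tz3.inV tF tW.inV
      (hV ▸ H.quadForm_l1.inV) hcF γ δ
  · refine exists_lift_hat hA H (m6 := 7) (n6 := 9)
      (c5 := u ^ 14 * (s * w ^ 2 + 2 * p * ξ * w + l * ξ ^ 2)) ?_ tF ?_ (by omega) (by omega)
      (by omega) hcF (mul_ne_zero (pow_ne_zero _ hu) hK) γ δ
    · rw [hatTr_eq h1, map_add, map_mul, map_mul _ z2]
      exact ((y0.inV.mul tW.inV).mono (by omega) (by omega)).add
        ((tz2.inV.mul tF.inV).mono (by omega) (by omega))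
    · have e : φ (hatTg A d) = φ (affImg A d 0) * φ (C t * hatTf A d + affImg A d 0) ^ 2 +
          2 * (φ z2 * φ (hatTf A d) * φ (C t * hatTf A d + affImg A d 0)) +
          φ z3 * φ (hatTf A d) ^ 2 := by
        rw [hatTg_eq h1 h2]
        simp only [map_add, map_mul, map_pow, map_ofNat]
      rw [e]
      refine (((y0.mul (tW.pow 2)).add (((tz2.mul tF).mul tW).ofNat_mul 2)).add
        (tz3.mul (tF.pow 2))).congr ?_
      simp only [OfNat.ofNat]
      ring

end Shear

/-- (Proposition 1 of the paper.)  For any `γ, δ ≥ 1`,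
`u ∈ k^*` and `α ∈ Aff_3(k) \ B`, there exist `γ' ≥ γ`, `δ' ≥ δ` and a lift
`α'` of `α` such that `(φ'_u ∘ α')(P_{γ,δ}) ⊆ P_{γ',δ'}`. -/
theorem statement11 [CharZero k]
    (hln6 : ∀ p : MvPolynomial (Fin 6) k, ∃ l : ℕ, Del'^[l] p = 0)
    (γ δ : ℕ) (hγ : 1 ≤ γ) (hδ : 1 ≤ δ)
    (u : k) (hu : u ≠ 0)
    (φ' : MvPolynomial (Fin 6) k ≃ₐ[k] MvPolynomial (Fin 6) k)
    (hφ' : IsExpOf (fun p => u • Del' p) φ')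
    (α : MvPolynomial (Fin 3) k ≃ₐ[k] MvPolynomial (Fin 3) k)
    (hα : IsAffine α) (hαB : α ∉ BSet) :
    ∃ γ' δ' : ℕ, γ ≤ γ' ∧ δ ≤ δ' ∧
      ∃ α' : MvPolynomial (Fin 6) k →ₐ[k] MvPolynomial (Fin 6) k,
        IsLift α α' ∧ ∀ p ∈ Pset γ δ, φ' (α' p) ∈ Pset γ' δ' := by
  obtain ⟨A, d, hunit, hA⟩ := hα
  have hdet := hunit.ne_zero
  have H := hφ'.expTops
  change LiftsInto (φ' : MvPolynomial (Fin 6) k →ₐ[k] MvPolynomial (Fin 6) k) α γ δ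
  by_cases hq : A 2 0 * A 2 2 - A 2 1 ^ 2 = 0 ∧
      A 1 0 * A 2 2 + A 2 0 * A 1 2 - 2 * (A 1 1 * A 2 1) = 0 ∧
      A 1 0 * A 1 2 - A 1 1 ^ 2 + (A 0 0 * A 2 2 - 2 * (A 0 1 * A 2 1) + A 0 2 * A 2 0) = 0
  swap
  · exact exists_lift_of_quadratic hA H hu hdet hq γ δ
  obtain ⟨q33, q23, q22⟩ := hq
  rw [Matrix.det_fin_three] at hdet
  by_cases h20 : A 2 0 = 0
  · have h21 : A 2 1 = 0 := by simpa [h20] using q33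
    have h22 : A 2 2 ≠ 0 := fun h => hdet (by rw [h20, h21, h]; ring)
    have h10 : A 1 0 = 0 := by simpa [h20, h21, h22] using q23
    rw [h10, h20, h21] at hdet q22
    refine exists_lift_of_triangular hA H hu hαB h10 h20 h21 (fun h => hdet ?_)
      (fun h => hdet ?_) h22 (by linear_combination q22) γ δ
    · rw [h]
      ring
    · rw [h]
      ring
  · obtain ⟨t, ht⟩ : ∃ t, A 2 1 = t * A 2 0 := ⟨A 2 1 / A 2 0, by field_simp⟩
    have h22 : A 2 2 = t ^ 2 * A 2 0 := by
      apply mul_left_cancel₀ h20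
      rw [ht] at q33
      linear_combination q33
    have h12 : A 1 2 = 2 * t * (A 1 1 - t * A 1 0) + t ^ 2 * A 1 0 := by
      apply mul_left_cancel₀ h20
      rw [ht, h22] at q23
      linear_combination q23
    rw [ht, h22, h12] at q22 hdet
    refine exists_lift_of_shear (s := A 2 0) (t := t) (q := A 1 0) (p := A 1 1 - t * A 1 0)
      (m := A 0 1 - t * A 0 0) (l := A 0 2 - 2 * t * A 0 1 + t ^ 2 * A 0 0) (a := A 0 0)
      (b := d 0) (e2 := d 1 - t * d 0) (e3 := d 2 - 2 * t * d 1 + t ^ 2 * d 0) hA H hu h20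
      (fun hp => hdet ?_) (by linear_combination q22) rfl (by ring) (by ring) rfl (by ring) h12
      rfl ht h22 rfl (by ring) (by ring) γ δ
    have hl : A 0 2 - 2 * t * A 0 1 + t ^ 2 * A 0 0 = 0 := by
      apply mul_left_cancel₀ h20
      linear_combination q22 + (A 1 1 - t * A 1 0) * hp
    linear_combination -(A 2 0 * (A 1 1 - t * A 1 0)) * hl

end YasudaPaper
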